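/- arXiv:1512.08494 — 2 statements merged into one kernel-verified Lean document; each statement's English description precedes it below -/
import Mathlib

section
/- Let n, k ∈ ℕ with 3 ≤ k ≤ n−2. If two internal-nonzero-weighted essential pseudostars of kind (n,k) with leaf set [n] realize the same family {D_I} of real numbers indexed by the k-subsets of [n], then they have the same Buneman indices: for all distinct leaves i,j,l,m, the index ⟨i,j | l,m⟩ holds in one if and only if it holds in the other. -/
/-- A weighted finite tree with leaf set labelled by `Fin n`:
a finite vertex type `V`, a tree `G` on `V`, an injective labelling `leaf` of the
degree-one vertices by `Fin n` (every vertex of degree one is a labelled leaf),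
and a weight function `w` on edges (zero off the edge set). -/
structure WTree (n : ℕ) where
  V : Type
  fintypeV : Fintype V
  G : SimpleGraph V
  isTree : G.IsTree
  leaf : Fin n → V
  leafInj : Function.Injective leaf
  leafSpec : ∀ v : V, (G.neighborSet v).ncard = 1 ↔ v ∈ Set.range leaf
  w : Sym2 V → ℝ
  wSupport : ∀ e, e ∉ G.edgeSet → w e = 0

namespace WTree

variable {n : ℕ}

/-- The degree of a vertex. -/
noncomputable def deg (T : WTree n) (v : T.V) : ℕ := (T.G.neighborSet v).ncard

/-- A node is a vertex of degree `> 2`. -/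
def IsNode (T : WTree n) (v : T.V) : Prop := 2 < T.deg v

/-- A tree is essential if it has no vertices of degree `2`. -/
def Essential (T : WTree n) : Prop := ∀ v : T.V, T.deg v ≠ 2

/-- The set of edges lying on the path between two vertices. -/
def pathEdges (T : WTree n) (u v : T.V) : Set (Sym2 T.V) :=
  {e | ∃ p : T.G.Walk u v, p.IsPath ∧ e ∈ p.edges}

/-- The edge set of the minimal subtree containing the leaves in `S`. -/
def subtreeEdges (T : WTree n) (S : Set (Fin n)) : Set (Sym2 T.V) :=
  {e | ∃ i ∈ S, ∃ j ∈ S, e ∈ T.pathEdges (T.leaf i) (T.leaf j)}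

/-- `D_I(T)`: the weight of the minimal subtree of `T` containing the leaves in `I`. -/
noncomputable def D (T : WTree n) (I : Finset (Fin n)) : ℝ :=
  ∑ᶠ e ∈ T.subtreeEdges ↑I, T.w e

/-- The total weight of the tree. -/
noncomputable def Dtot (T : WTree n) : ℝ := ∑ᶠ e ∈ T.G.edgeSet, T.w e

/-- An edge is a twig edge if it lies on the path from some leaf to the nearest node. -/
def IsTwigEdge (T : WTree n) (e : Sym2 T.V) : Prop :=
  ∃ (i : Fin n) (v : T.V), T.IsNode v ∧
    ∃ p : T.G.Walk (T.leaf i) v, p.IsPath ∧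
      (∀ u ∈ p.support, T.IsNode u → u = v) ∧ e ∈ p.edges

/-- Internal-nonzero-weighted: every internal (non-twig) edge has nonzero weight. -/
def InternalNonzero (T : WTree n) : Prop :=
  ∀ e ∈ T.G.edgeSet, ¬ T.IsTwigEdge e → T.w e ≠ 0

/-- Positive-weighted: all edge weights are positive. -/
def PositiveWeighted (T : WTree n) : Prop := ∀ e ∈ T.G.edgeSet, 0 < T.w e

/-- The leaves lying on the side of vertex `a` after removing the edge `e`. -/
def sideLeaves (T : WTree n) (e : Sym2 T.V) (a : T.V) : Set (Fin n) :=
  {i | e ∉ T.pathEdges (T.leaf i) a}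

/-- A pseudostar of kind `(n, k)`: every edge divides the leaf set into two parts,
at least one of which has cardinality `≥ k`. -/
def IsPseudostar (T : WTree n) (k : ℕ) : Prop :=
  ∀ a b : T.V, T.G.Adj a b →
    k ≤ (T.sideLeaves s(a, b) a).ncard ∨ k ≤ (T.sideLeaves s(a, b) b).ncard

/-- `T` realizes the family `D₀` of `k`-weights. -/
def Realizes (T : WTree n) (k : ℕ) (D₀ : Finset (Fin n) → ℝ) : Prop :=
  ∀ I : Finset (Fin n), I.card = k → T.D I = D₀ I

/-- Two leaves are neighbours if the path between them contains exactly one node. -/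
def Neighbours (T : WTree n) (i j : Fin n) : Prop :=
  i ≠ j ∧ ∃ p : T.G.Walk (T.leaf i) (T.leaf j), p.IsPath ∧
    ∃! v : T.V, v ∈ p.support ∧ T.IsNode v

/-- The Buneman index `⟨i,j | l,m⟩` holds iff the paths `i–j` and `l–m` are disjoint,
equivalently in `T|_{i,j,l,m}` the leaves `i,j` are neighbours, `l,m` are neighbours
and `i,l` are not neighbours. -/
def Buneman (T : WTree n) (i j l m : Fin n) : Prop :=
  ∀ (p : T.G.Walk (T.leaf i) (T.leaf j)) (q : T.G.Walk (T.leaf l) (T.leaf m)),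
    p.IsPath → q.IsPath → ∀ v : T.V, v ∈ p.support → v ∉ q.support

/-- The minimal subtree spanned by the four leaves `i,j,l,m` is a star (i.e. all
pairwise paths share a common vertex). -/
def StarQuartet (T : WTree n) (i j l m : Fin n) : Prop :=
  ∃ c : T.V, ∀ x ∈ ({i, j, l, m} : Set (Fin n)), ∀ y ∈ ({i, j, l, m} : Set (Fin n)),
    x ≠ y → ∀ p : T.G.Walk (T.leaf x) (T.leaf y), p.IsPath → c ∈ p.support

/-- A cherry: a set of leaves pairwise neighbours. -/
def IsCherry (T : WTree n) (C : Set (Fin n)) : Prop :=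
  ∀ i ∈ C, ∀ j ∈ C, i ≠ j → T.Neighbours i j

/-- A complete cherry: a cherry not strictly contained in another cherry. -/
def IsCompleteCherry (T : WTree n) (C : Set (Fin n)) : Prop :=
  T.IsCherry C ∧ ¬ ∃ C' : Set (Fin n), T.IsCherry C' ∧ C ⊂ C'

/-- A star is a tree with only one node. -/
def IsStar (T : WTree n) : Prop := ∃! v : T.V, T.IsNode v

/-- `x` is the median of the three leaves `a,b,c`: it lies on all three pairwise paths. -/
def IsMedian (T : WTree n) (a b c : Fin n) (x : T.V) : Prop :=
  (∀ p : T.G.Walk (T.leaf a) (T.leaf b), p.IsPath → x ∈ p.support) ∧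
  (∀ p : T.G.Walk (T.leaf a) (T.leaf c), p.IsPath → x ∈ p.support) ∧
  (∀ p : T.G.Walk (T.leaf b) (T.leaf c), p.IsPath → x ∈ p.support)

/-- The weight of the twig associated to the leaf `i` (the path from the leaf to the
nearest node). -/
noncomputable def twigWeight (T : WTree n) (i : Fin n) : ℝ :=
  ∑ᶠ e ∈ {e : Sym2 T.V | ∃ v : T.V, T.IsNode v ∧
      ∃ p : T.G.Walk (T.leaf i) v, p.IsPath ∧
        (∀ u ∈ p.support, T.IsNode u → u = v) ∧ e ∈ p.edges}, T.w e

/-- Two weighted trees with leaf set `Fin n` are equal (isomorphic respecting the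
leaf labels and the weights). -/
def Isom (T T' : WTree n) : Prop :=
  ∃ φ : T.V ≃ T'.V,
    (∀ a b : T.V, T.G.Adj a b ↔ T'.G.Adj (φ a) (φ b)) ∧
    (∀ i : Fin n, φ (T.leaf i) = T'.leaf i) ∧
    (∀ a b : T.V, T.w s(a, b) = T'.w s(φ a, φ b))

/-- `T'` is obtained from `T` by the `k`-IO operation on the edge `{a, b}`:
the edge divides the leaf set into two parts each of cardinality `< k`; it is
contracted (via the quotient map `φ`) and `w{a,b}/k` is added to the weight of
every twig (i.e. to every pendant edge). -/
def IOStepOn (k : ℕ) (T T' : WTree n) (a b : T.V) : Prop :=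
  T.G.Adj a b ∧
  (T.sideLeaves s(a, b) a).ncard < k ∧ (T.sideLeaves s(a, b) b).ncard < k ∧
  ∃ φ : T.V → T'.V,
    Function.Surjective φ ∧ φ a = φ b ∧
    (∀ x y : T.V, φ x = φ y → x = y ∨ s(x, y) = s(a, b)) ∧
    (∀ i : Fin n, φ (T.leaf i) = T'.leaf i) ∧
    (∀ u v : T'.V, T'.G.Adj u v ↔
      ∃ x y : T.V, φ x = u ∧ φ y = v ∧ T.G.Adj x y ∧ s(x, y) ≠ s(a, b)) ∧
    (∀ x y : T.V, T.G.Adj x y → s(x, y) ≠ s(a, b) →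
      ((∃ i : Fin n, T.leaf i = x ∨ T.leaf i = y) →
        T'.w s(φ x, φ y) = T.w s(x, y) + T.w s(a, b) / k) ∧
      (¬ (∃ i : Fin n, T.leaf i = x ∨ T.leaf i = y) →
        T'.w s(φ x, φ y) = T.w s(x, y)))

/-- `T'` is obtained from `T` by a `k`-IO operation. -/
def IOStep (k : ℕ) (T T' : WTree n) : Prop := ∃ a b : T.V, IOStepOn k T T' a b

/-- `T'` is obtained from `T` by a `k`-OI operation (the inverse of a `k`-IO operation). -/
def OIStep (k : ℕ) (T T' : WTree n) : Prop := IOStep k T' T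

/-- `T'` is obtained from `T` by inserting an internal edge of weight `0`
(the inverse of contracting it). -/
def InsertZeroStep (T T' : WTree n) : Prop :=
  ∃ a b : T'.V, T'.G.Adj a b ∧ ¬ T'.IsTwigEdge s(a, b) ∧ T'.w s(a, b) = 0 ∧
    ∃ φ : T'.V → T.V,
      Function.Surjective φ ∧ φ a = φ b ∧
      (∀ x y : T'.V, φ x = φ y → x = y ∨ s(x, y) = s(a, b)) ∧
      (∀ i : Fin n, φ (T'.leaf i) = T.leaf i) ∧
      (∀ u v : T.V, T.G.Adj u v ↔
        ∃ x y : T'.V, φ x = u ∧ φ y = v ∧ T'.G.Adj x y ∧ s(x, y) ≠ s(a, b)) ∧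
      (∀ x y : T'.V, T'.G.Adj x y → s(x, y) ≠ s(a, b) → T.w s(φ x, φ y) = T'.w s(x, y))

/-- Replace the weight function of `T`. -/
def reweight (T : WTree n) (w' : Sym2 T.V → ℝ)
    (h : ∀ e, e ∉ T.G.edgeSet → w' e = 0) : WTree n :=
  { T with w := w', wSupport := h }

end WTree

namespace WTree

variable {n : ℕ}

section PathEdges

variable {T : WTree n}

lemma mem_pathEdges_iff {u v : T.V} {p : T.G.Walk u v} (hp : p.IsPath) {e : Sym2 T.V} :
    e ∈ T.pathEdges u v ↔ e ∈ p.edges := by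
  refine ⟨?_, fun h => ⟨p, hp, h⟩⟩
  rintro ⟨q, hq, he⟩
  have : p = q := congrArg Subtype.val
    ((T.isTree.isAcyclic.subsingleton_path u v).elim ⟨p, hp⟩ ⟨q, hq⟩)
  rwa [this]

lemma exists_isPath (T : WTree n) (u v : T.V) : ∃ p : T.G.Walk u v, p.IsPath :=
  T.isTree.connected.exists_isPath u v

/-- An edge misses the path from `u` to `v` as soon as it misses some walk from `u` to `v`. -/
lemma notMem_pathEdges_of_walk {u v : T.V} (p : T.G.Walk u v) {e : Sym2 T.V}
    (he : e ∉ p.edges) : e ∉ T.pathEdges u v := by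
  classical
  rw [mem_pathEdges_iff p.bypass_isPath]
  exact fun h => he (p.edges_bypass_subset_edges h)

lemma notMem_pathEdges_iff {u v : T.V} {e : Sym2 T.V} :
    e ∉ T.pathEdges u v ↔ ∃ p : T.G.Walk u v, e ∉ p.edges := by
  refine ⟨fun h => ?_, fun ⟨p, hp⟩ => notMem_pathEdges_of_walk p hp⟩
  obtain ⟨p, hp⟩ := T.exists_isPath u v
  exact ⟨p, fun he => h ⟨p, hp, he⟩⟩

lemma notMem_pathEdges_self (e : Sym2 T.V) (u : T.V) : e ∉ T.pathEdges u u :=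
  notMem_pathEdges_of_walk .nil (by simp)

lemma notMem_pathEdges_symm {e : Sym2 T.V} {u v : T.V} (h : e ∉ T.pathEdges u v) :
    e ∉ T.pathEdges v u := by
  obtain ⟨p, hp⟩ := notMem_pathEdges_iff.1 h
  exact notMem_pathEdges_of_walk p.reverse (by simpa using hp)

lemma notMem_pathEdges_trans {e : Sym2 T.V} {u v w : T.V} (h : e ∉ T.pathEdges u v)
    (h' : e ∉ T.pathEdges v w) : e ∉ T.pathEdges u w := by
  obtain ⟨p, hp⟩ := notMem_pathEdges_iff.1 h
  obtain ⟨q, hq⟩ := notMem_pathEdges_iff.1 h'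
  exact notMem_pathEdges_of_walk (p.append q) (by simp [SimpleGraph.Walk.edges_append, hp, hq])

lemma notMem_pathEdges_or_of_mem_support {u v w : T.V} {p : T.G.Walk u w} (hp : p.IsPath)
    (hv : v ∈ p.support) (e : Sym2 T.V) : e ∉ T.pathEdges u v ∨ e ∉ T.pathEdges v w := by
  classical
  by_contra! h
  rw [mem_pathEdges_iff (hp.takeUntil hv), mem_pathEdges_iff (hp.dropUntil hv)] at h
  exact hp.isTrail.disjoint_edges_takeUntil_dropUntil hv h.1 h.2

lemma notMem_pathEdges_of_mem_support {u v w : T.V} {p : T.G.Walk u w}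
    (hv : v ∈ p.support) {e : Sym2 T.V} (he : e ∉ p.edges) : e ∉ T.pathEdges u v := by
  classical
  exact notMem_pathEdges_of_walk (p.takeUntil v hv)
    fun h => he (p.edges_takeUntil_subset_edges hv h)

lemma mem_pathEdges_of_adj {x y : T.V} (h : T.G.Adj x y) {e : Sym2 T.V} :
    e ∈ T.pathEdges x y ↔ e = s(x, y) := by
  have hp : (SimpleGraph.Walk.cons h .nil).IsPath := by
    simpa [SimpleGraph.Walk.cons_isPath_iff] using h.ne
  simp [mem_pathEdges_iff hp]

lemma mem_edgeSet_of_mem_pathEdges {u v : T.V} {e : Sym2 T.V} (h : e ∈ T.pathEdges u v) :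
    e ∈ T.G.edgeSet := by
  obtain ⟨p, -, he⟩ := h
  exact p.edges_subset_edgeSet he

/-- Removing an edge splits the tree in exactly two sides. -/
lemma notMem_pathEdges_left_or_right {x y : T.V} (h : T.G.Adj x y) (u : T.V) :
    s(x, y) ∉ T.pathEdges u x ∨ s(x, y) ∉ T.pathEdges u y := by
  by_contra! H
  obtain ⟨p, hp⟩ := T.exists_isPath u x
  have hy := p.snd_mem_support_of_mem_edges ((mem_pathEdges_iff hp).1 H.1)
  rcases notMem_pathEdges_or_of_mem_support hp hy s(x, y) with h' | h'
  · exact h' H.2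
  · exact notMem_pathEdges_symm h' ((mem_pathEdges_of_adj h).2 rfl)

lemma notMem_pathEdges_of_mem_of_mem {e : Sym2 T.V} {u v w : T.V} (h : e ∈ T.pathEdges u v)
    (h' : e ∈ T.pathEdges v w) : e ∉ T.pathEdges u w := by
  have he := mem_edgeSet_of_mem_pathEdges h
  induction e with | _ x y
  have key := notMem_pathEdges_left_or_right (T := T) he
  have sy := fun {a b} => notMem_pathEdges_symm (T := T) (e := s(x, y)) (u := a) (v := b)
  have tr := fun {a b c} =>
    notMem_pathEdges_trans (T := T) (e := s(x, y)) (u := a) (v := b) (w := c)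
  rcases key u with hu | hu <;> rcases key v with hv | hv <;> rcases key w with hw | hw
  all_goals first
    | exact tr hu (sy hw)
    | exact absurd h (tr hu (sy hv))
    | exact absurd h' (tr hv (sy hw))

/-- Two edges issuing from `x` and lying on a common path from `x` coincide. -/
lemma eq_of_mem_pathEdges_of_mem_pathEdges {x y z v : T.V} (hy : s(x, y) ∈ T.pathEdges x v)
    (hz : s(x, z) ∈ T.pathEdges x v) : y = z := by
  obtain ⟨p, hp⟩ := T.exists_isPath x v
  rw [mem_pathEdges_iff hp] at hy hz
  cases p with
  | nil => simp at hy
  | @cons _ c _ h q =>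
    rw [SimpleGraph.Walk.cons_isPath_iff] at hp
    have key : ∀ t, s(x, t) ∈ (SimpleGraph.Walk.cons h q).edges → t = c := by
      intro t ht
      rw [SimpleGraph.Walk.edges_cons, List.mem_cons] at ht
      rcases ht with ht | ht
      · exact Sym2.congr_right.1 ht
      · exact absurd (q.fst_mem_support_of_mem_edges ht) hp.2
    rw [key y hy, key z hz]

/-- If an edge `f` separates `a, b` from `c, d`, no edge lies both on the path from `a` to `b`
and on the path from `c` to `d`. -/
lemma notMem_pathEdges_of_separates {e f : Sym2 T.V} {a b c d : T.V}
    (hab : f ∉ T.pathEdges a b) (hcd : f ∉ T.pathEdges c d) (hac : f ∈ T.pathEdges a c)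
    (he : e ∈ T.pathEdges a b) : e ∉ T.pathEdges c d := by
  intro he'
  obtain ⟨p, hp⟩ := T.exists_isPath a b
  obtain ⟨q, hq⟩ := T.exists_isPath c d
  rw [mem_pathEdges_iff hp] at hab he
  rw [mem_pathEdges_iff hq] at hcd he'
  induction e with | _ x y
  have h₁ := notMem_pathEdges_of_mem_support (p.fst_mem_support_of_mem_edges he) hab
  have h₂ := notMem_pathEdges_of_mem_support (q.fst_mem_support_of_mem_edges he') hcd
  exact notMem_pathEdges_trans h₁ (notMem_pathEdges_symm h₂) hac

lemma Buneman.exists_adj {i j l m : Fin n} (h : T.Buneman i j l m) :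
    ∃ x y, T.G.Adj x y ∧ s(x, y) ∉ T.pathEdges (T.leaf i) x ∧
      s(x, y) ∉ T.pathEdges (T.leaf j) x ∧ s(x, y) ∉ T.pathEdges (T.leaf l) y ∧
      s(x, y) ∉ T.pathEdges (T.leaf m) y := by
  obtain ⟨p, hp⟩ := T.exists_isPath (T.leaf i) (T.leaf j)
  obtain ⟨q, hq⟩ := T.exists_isPath (T.leaf l) (T.leaf m)
  obtain ⟨r, hr⟩ := T.exists_isPath (T.leaf i) (T.leaf l)
  obtain ⟨d, hd, hd₁, hd₂⟩ := r.exists_boundary_dart {v | v ∈ p.support} p.start_mem_support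
    (fun h' => h p q hp hq _ h' q.start_mem_support)
  have hdr : s(d.fst, d.snd) ∈ r.edges := List.mem_map.2 ⟨d, hd, rfl⟩
  have hdp : s(d.fst, d.snd) ∉ p.edges := fun h' => hd₂ (p.snd_mem_support_of_mem_edges h')
  have hdq : s(d.fst, d.snd) ∉ q.edges := fun h' =>
    h p q hp hq _ hd₁ (q.fst_mem_support_of_mem_edges h')
  have hi := notMem_pathEdges_of_mem_support hd₁ hdp
  have hij := notMem_pathEdges_of_walk p hdp
  have hlm := notMem_pathEdges_of_walk q hdq
  have hl : s(d.fst, d.snd) ∉ T.pathEdges (T.leaf l) d.snd := by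
    rcases notMem_pathEdges_left_or_right d.adj (T.leaf l) with h' | h'
    · exact absurd ((mem_pathEdges_iff hr).2 hdr)
        (notMem_pathEdges_trans hi (notMem_pathEdges_symm h'))
    · exact h'
  exact ⟨d.fst, d.snd, d.adj, hi, notMem_pathEdges_trans (notMem_pathEdges_symm hij) hi, hl,
    notMem_pathEdges_trans (notMem_pathEdges_symm hlm) hl⟩

lemma buneman_of_separates {f : Sym2 T.V} {i j l m : Fin n}
    (hij : f ∉ T.pathEdges (T.leaf i) (T.leaf j)) (hlm : f ∉ T.pathEdges (T.leaf l) (T.leaf m))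
    (hil : f ∈ T.pathEdges (T.leaf i) (T.leaf l)) : T.Buneman i j l m := by
  intro p q hp hq v hvp hvq
  rw [mem_pathEdges_iff hp] at hij
  rw [mem_pathEdges_iff hq] at hlm
  exact notMem_pathEdges_trans (notMem_pathEdges_of_mem_support hvp hij)
    (notMem_pathEdges_symm (notMem_pathEdges_of_mem_support hvq hlm)) hil

lemma Buneman.symm {i j l m : Fin n} (h : T.Buneman i j l m) : T.Buneman l m i j :=
  fun p q hp hq v hvp hvq => h q p hq hp v hvq hvp

lemma Buneman.trans {i j a l m : Fin n} (hi : T.Buneman i a l m) (hj : T.Buneman j a l m) :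
    T.Buneman i j l m := by
  classical
  intro p q hp hq v hvp hvq
  obtain ⟨r, hr⟩ := T.exists_isPath (T.leaf i) (T.leaf a)
  obtain ⟨s, hs⟩ := T.exists_isPath (T.leaf j) (T.leaf a)
  have hpq : p = (r.append s.reverse).bypass := congrArg Subtype.val
    ((T.isTree.isAcyclic.subsingleton_path _ _).elim ⟨p, hp⟩ ⟨_, SimpleGraph.Walk.bypass_isPath _⟩)
  rw [hpq] at hvp
  have hv := SimpleGraph.Walk.support_bypass_subset_support _ hvp
  rw [SimpleGraph.Walk.mem_support_append_iff, SimpleGraph.Walk.support_reverse,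
    List.mem_reverse] at hv
  rcases hv with hv | hv
  · exact hi r q hr hq v hv hvq
  · exact hj s q hs hq v hv hvq

lemma mem_pathEdges_of_sides {x y u v : T.V} (hxy : T.G.Adj x y)
    (hu : s(x, y) ∉ T.pathEdges u x) (hv : s(x, y) ∉ T.pathEdges v y) :
    s(x, y) ∈ T.pathEdges u v := by
  by_contra h
  exact notMem_pathEdges_trans (notMem_pathEdges_symm hu) (notMem_pathEdges_trans h hv)
    ((mem_pathEdges_of_adj hxy).2 rfl)

/-- If `x` lies between `a` and `a'`, and `y` between `b` and `b'`, the edge from `x` to `y` is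
the only one which the paths from `a` to `b` and from `a'` to `b'` may share. -/
lemma eq_of_mem_pathEdges_cross {x y a a' b b' : T.V} (hxy : T.G.Adj x y)
    (ha : s(x, y) ∉ T.pathEdges a x) (ha' : s(x, y) ∉ T.pathEdges a' x)
    (hb : s(x, y) ∉ T.pathEdges b y) (hb' : s(x, y) ∉ T.pathEdges b' y)
    (hx : ∀ f, f ∉ T.pathEdges a x ∨ f ∉ T.pathEdges a' x)
    (hy : ∀ f, f ∉ T.pathEdges b y ∨ f ∉ T.pathEdges b' y)
    {f : Sym2 T.V} (hf : f ∈ T.pathEdges a b) (hf' : f ∈ T.pathEdges a' b') :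
    f = s(x, y) := by
  by_contra hne
  have hfxy : f ∉ T.pathEdges x y := fun h => hne ((mem_pathEdges_of_adj hxy).1 h)
  have key : ∀ a a' b b' : T.V, s(x, y) ∉ T.pathEdges a x → s(x, y) ∉ T.pathEdges a' x →
      s(x, y) ∉ T.pathEdges b y → s(x, y) ∉ T.pathEdges b' y →
      (f ∉ T.pathEdges b y ∨ f ∉ T.pathEdges b' y) →
      f ∈ T.pathEdges a b → f ∈ T.pathEdges a' b' → f ∉ T.pathEdges a x → False := by
    intro a a' b b' ha ha' hb hb' hy hf hf' hax
    have hay := notMem_pathEdges_trans hax hfxy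
    have hby : f ∈ T.pathEdges b y := by
      by_contra h
      exact notMem_pathEdges_trans hay (notMem_pathEdges_symm h) hf
    have hab' := notMem_pathEdges_trans hay
      (notMem_pathEdges_symm (hy.resolve_left (not_not.2 hby)))
    have haa' : f ∈ T.pathEdges a a' := by
      by_contra h
      exact notMem_pathEdges_trans (notMem_pathEdges_symm h) hab' hf'
    have ha'b : f ∉ T.pathEdges a' b := fun h => notMem_pathEdges_of_mem_of_mem haa' h hf
    exact notMem_pathEdges_of_separates hab' ha'b haa' (mem_pathEdges_of_sides hxy ha hb')
      (mem_pathEdges_of_sides hxy ha' hb)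
  rcases hx f with h | h
  · exact key a a' b b' ha ha' hb hb' (hy f) hf hf' h
  · exact key a' a b' b ha' ha hb' hb (hy f).symm hf' hf h

/-- Every path can be prolonged up to a leaf. -/
lemma exists_leaf_of_mem_pathEdges {e : Sym2 T.V} {x v : T.V} (h : e ∈ T.pathEdges x v) :
    ∃ i, e ∈ T.pathEdges x (T.leaf i) := by
  have := T.fintypeV
  suffices key : ∀ (N : ℕ) (v : T.V) (p : T.G.Walk x v), p.IsPath → e ∈ p.edges →
      Fintype.card T.V ≤ p.length + N → ∃ i, e ∈ T.pathEdges x (T.leaf i) by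
    obtain ⟨p, hp, he⟩ := h
    exact key _ v p hp he (Nat.le_add_left _ _)
  intro N
  induction N with
  | zero => exact fun v p hp _ hN => absurd hp.length_lt (not_lt.2 hN)
  | succ N ih =>
    intro v p hp he hN
    by_cases hv : (T.G.neighborSet v).ncard = 1
    · obtain ⟨i, rfl⟩ := (T.leafSpec v).1 hv
      exact ⟨i, p, hp, he⟩
    have hnil : ¬ p.Nil := by
      intro h
      rw [SimpleGraph.Walk.edges_eq_nil.2 h] at he
      simp at he
    have hadj := p.adj_penultimate hnil
    have hpos : 0 < (T.G.neighborSet v).ncard :=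
      (Set.ncard_pos (Set.toFinite _)).2 ⟨_, hadj.symm⟩
    obtain ⟨u, hu, hne⟩ := Set.exists_ne_of_one_lt_ncard
      (show 1 < (T.G.neighborSet v).ncard by omega) p.penultimate
    rw [SimpleGraph.mem_neighborSet] at hu
    have hpen : s(v, p.penultimate) ∈ T.pathEdges v x := by
      rw [mem_pathEdges_iff hp.reverse, SimpleGraph.Walk.edges_reverse, List.mem_reverse,
        Sym2.eq_swap]
      exact p.mk_penultimate_end_mem_edges hnil
    have hup : u ∉ p.support := by
      intro hup
      have huv : s(v, u) ∉ p.reverse.edges := fun h =>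
        hne (eq_of_mem_pathEdges_of_mem_pathEdges ((mem_pathEdges_iff hp.reverse).2 h) hpen)
      exact notMem_pathEdges_of_mem_support (by simpa using hup) huv
        ((mem_pathEdges_of_adj hu).2 rfl)
    refine ih u (p.concat hu) (hp.concat hup hu) ?_ ?_
    · rw [SimpleGraph.Walk.edges_concat]
      simp [he]
    · rw [SimpleGraph.Walk.length_concat]
      omega

/-- In an essential tree, an endpoint of an edge with two leaves on its side is a node. -/
lemma isNode_of_two_leaves (hT : T.Essential) {x y : T.V} (hxy : T.G.Adj x y) {i i' : Fin n}
    (hne : i ≠ i') (hi : s(x, y) ∉ T.pathEdges (T.leaf i) x)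
    (hi' : s(x, y) ∉ T.pathEdges (T.leaf i') x) : T.IsNode x := by
  have := T.fintypeV
  have hpos : 0 < T.deg x := (Set.ncard_pos (Set.toFinite _)).2 ⟨y, hxy⟩
  have h2 := hT x
  have h1 : T.deg x ≠ 1 := by
    intro h1
    obtain ⟨z, hz⟩ := Set.ncard_eq_one.1 h1
    have hzy : y = z := by
      have : y ∈ T.G.neighborSet x := hxy
      simpa [hz] using this
    have key : ∀ a, s(x, y) ∉ T.pathEdges (T.leaf a) x → T.leaf a = x := by
      intro a ha
      by_contra hax
      obtain ⟨p, hp⟩ := T.exists_isPath x (T.leaf a)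
      have ha' := notMem_pathEdges_symm ha
      rw [mem_pathEdges_iff hp] at ha'
      cases hnil : p with
      | nil => exact hax rfl
      | @cons _ c _ h q =>
        have hc : c = z := by
          have : c ∈ T.G.neighborSet x := h
          simpa [hz] using this
        simp [hnil, hc, hzy] at ha'
    exact hne (T.leafInj ((key i hi).trans (key i' hi').symm))
  unfold IsNode
  omega

lemma notMem_pathEdges_or_of_mem {x t u v : T.V} (h : s(x, t) ∈ T.pathEdges u v)
    (f : Sym2 T.V) : f ∉ T.pathEdges u x ∨ f ∉ T.pathEdges v x := by
  obtain ⟨p, hp⟩ := T.exists_isPath u v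
  rw [mem_pathEdges_iff hp] at h
  exact (notMem_pathEdges_or_of_mem_support hp (p.fst_mem_support_of_mem_edges h) f).imp_right
    notMem_pathEdges_symm

/-- Given two leaves and a node `x` with a neighbour `y`, either `x` lies between the two leaves,
or there is a third leaf on the side of `x` such that `x` lies between it and each of the two. -/
lemma between_or_exists_between {x : T.V} (hx : T.IsNode x) (y : T.V) (i i' : Fin n) :
    (∀ f, f ∉ T.pathEdges (T.leaf i) x ∨ f ∉ T.pathEdges (T.leaf i') x) ∨
    ∃ a, i ≠ a ∧ i' ≠ a ∧ s(x, y) ∉ T.pathEdges (T.leaf a) x ∧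
      (∀ f, f ∉ T.pathEdges (T.leaf i) x ∨ f ∉ T.pathEdges (T.leaf a) x) ∧
      (∀ f, f ∉ T.pathEdges (T.leaf i') x ∨ f ∉ T.pathEdges (T.leaf a) x) := by
  refine or_iff_not_imp_left.2 fun hbetween => ?_
  push Not at hbetween
  obtain ⟨f, hf, hf'⟩ := hbetween
  have hii' : ∀ t, s(x, t) ∉ T.pathEdges (T.leaf i) (T.leaf i') := fun t ht =>
    (notMem_pathEdges_or_of_mem ht f).elim (· hf) (· hf')
  obtain ⟨z, hz⟩ : ∃ z, ∀ t, s(x, t) ∈ T.pathEdges x (T.leaf i) → t = z := by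
    by_cases h : ∃ z, s(x, z) ∈ T.pathEdges x (T.leaf i)
    · obtain ⟨z, hz⟩ := h
      exact ⟨z, fun t ht => eq_of_mem_pathEdges_of_mem_pathEdges ht hz⟩
    · exact ⟨x, fun t ht => absurd ⟨t, ht⟩ h⟩
  have hcard : ({y, z} : Set T.V).ncard < (T.G.neighborSet x).ncard := by
    have h := Set.ncard_insert_le y {z}
    rw [Set.ncard_singleton] at h
    exact lt_of_le_of_lt h hx
  obtain ⟨t, ht, htn⟩ := Set.exists_mem_notMem_of_ncard_lt_ncard hcard
  simp only [Set.mem_insert_iff, Set.mem_singleton_iff, not_or] at htn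
  obtain ⟨a, ha⟩ := exists_leaf_of_mem_pathEdges ((mem_pathEdges_of_adj ht).2 rfl)
  have hti : s(x, t) ∉ T.pathEdges (T.leaf i) x := notMem_pathEdges_symm fun h => htn.2 (hz t h)
  have hti' := notMem_pathEdges_trans (notMem_pathEdges_symm (hii' t)) hti
  have hia : s(x, t) ∈ T.pathEdges (T.leaf i) (T.leaf a) := by
    by_contra h
    exact notMem_pathEdges_trans (notMem_pathEdges_symm hti) h ha
  have hia' : s(x, t) ∈ T.pathEdges (T.leaf i') (T.leaf a) := by
    by_contra h
    exact notMem_pathEdges_trans (notMem_pathEdges_symm hti') h ha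
  refine ⟨a, ?_, ?_, ?_, notMem_pathEdges_or_of_mem hia, notMem_pathEdges_or_of_mem hia'⟩
  · rintro rfl
    exact notMem_pathEdges_self _ _ hia
  · rintro rfl
    exact notMem_pathEdges_self _ _ hia'
  · exact notMem_pathEdges_symm fun h => htn.1 (eq_of_mem_pathEdges_of_mem_pathEdges ha h)

lemma InternalNonzero.weight_ne_zero (hT : T.InternalNonzero) {x y : T.V} (hxy : T.G.Adj x y)
    (hx : T.IsNode x) (hy : T.IsNode y) : T.w s(x, y) ≠ 0 := by
  refine hT _ hxy ?_
  rintro ⟨i, v, -, p, -, hnode, he⟩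
  exact hxy.ne ((hnode x (p.fst_mem_support_of_mem_edges he) hx).trans
    (hnode y (p.snd_mem_support_of_mem_edges he) hy).symm)

end PathEdges

/-- The second difference of `D` at `R` along the two pairs `(i, j)` and `(i', j')`. -/
noncomputable def crossDiff (T : WTree n) (R : Finset (Fin n)) (i i' j j' : Fin n) : ℝ :=
  T.D (insert i (insert i' R)) + T.D (insert j (insert j' R))
    - T.D (insert i (insert j' R)) - T.D (insert j (insert i' R))

section CrossDiff

variable {T : WTree n}

lemma subtreeEdges_insert_subset {f : Sym2 T.V} {i j : Fin n} {S : Set (Fin n)}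
    (h : f ∉ T.pathEdges (T.leaf i) (T.leaf j)) (hf : f ∈ T.subtreeEdges (insert i S)) :
    f ∈ T.subtreeEdges (insert j S) := by
  have key : ∀ a ∈ insert i S, ∃ b ∈ insert j S, f ∉ T.pathEdges (T.leaf a) (T.leaf b) := by
    rintro a (rfl | ha)
    · exact ⟨j, .inl rfl, h⟩
    · exact ⟨a, .inr ha, notMem_pathEdges_self _ _⟩
  obtain ⟨a, ha, b, hb, hab⟩ := hf
  obtain ⟨a', ha', haa'⟩ := key a ha
  obtain ⟨b', hb', hbb'⟩ := key b hb
  refine ⟨a', ha', b', hb', ?_⟩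
  by_contra h'
  exact notMem_pathEdges_trans (notMem_pathEdges_trans haa' h') (notMem_pathEdges_symm hbb') hab

lemma mem_subtreeEdges_insert_congr {f : Sym2 T.V} {i j : Fin n} {S : Set (Fin n)}
    (h : f ∉ T.pathEdges (T.leaf i) (T.leaf j)) :
    f ∈ T.subtreeEdges (insert i S) ↔ f ∈ T.subtreeEdges (insert j S) :=
  ⟨subtreeEdges_insert_subset h, subtreeEdges_insert_subset (notMem_pathEdges_symm h)⟩

open Classical in
lemma D_eq_sum [Fintype T.V] (I : Finset (Fin n)) :
    T.D I = ∑ e : Sym2 T.V, if e ∈ T.subtreeEdges ↑I then T.w e else 0 := by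
  rw [D, finsum_mem_def, finsum_eq_sum_of_fintype]
  rfl

open Classical in
lemma crossDiff_eq_sum [Fintype T.V] (R : Finset (Fin n)) (i i' j j' : Fin n) :
    T.crossDiff R i i' j j' = ∑ e : Sym2 T.V,
      ((if e ∈ T.subtreeEdges (insert i (insert i' ↑R)) then T.w e else 0)
        + (if e ∈ T.subtreeEdges (insert j (insert j' ↑R)) then T.w e else 0)
        - (if e ∈ T.subtreeEdges (insert i (insert j' ↑R)) then T.w e else 0)
        - (if e ∈ T.subtreeEdges (insert j (insert i' ↑R)) then T.w e else 0)) := by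
  simp only [crossDiff, D_eq_sum, Finset.sum_add_distrib, Finset.sum_sub_distrib,
    Finset.coe_insert]

open Classical in
lemma cross_eq_zero {e : Sym2 T.V} {R : Set (Fin n)} {i i' j j' : Fin n}
    (h : e ∉ T.pathEdges (T.leaf i) (T.leaf j) ∨ e ∉ T.pathEdges (T.leaf i') (T.leaf j')) :
    ((if e ∈ T.subtreeEdges (insert i (insert i' R)) then T.w e else 0)
        + (if e ∈ T.subtreeEdges (insert j (insert j' R)) then T.w e else 0)
        - (if e ∈ T.subtreeEdges (insert i (insert j' R)) then T.w e else 0)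
        - (if e ∈ T.subtreeEdges (insert j (insert i' R)) then T.w e else 0)) = 0 := by
  rcases h with h | h
  · simp only [mem_subtreeEdges_insert_congr h]
    ring
  · simp only [Set.insert_comm _ i', mem_subtreeEdges_insert_congr h, Set.insert_comm _ j']
    ring

lemma exists_mem_of_crossDiff_ne_zero {R : Finset (Fin n)} {i i' j j' : Fin n}
    (h : T.crossDiff R i i' j j' ≠ 0) :
    ∃ f, f ∈ T.pathEdges (T.leaf i) (T.leaf j) ∧ f ∈ T.pathEdges (T.leaf i') (T.leaf j') := by
  have := T.fintypeV
  by_contra! hf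
  refine h ?_
  rw [crossDiff_eq_sum]
  exact Finset.sum_eq_zero fun e _ => cross_eq_zero (imp_iff_not_or.1 (hf e))

lemma crossDiff_comm (R : Finset (Fin n)) (i i' j j' : Fin n) :
    T.crossDiff R i i' j j' = T.crossDiff R j j' i i' := by
  unfold crossDiff
  ring

lemma crossDiff_eq_neg_weight {x y : T.V} (hxy : T.G.Adj x y) {R : Finset (Fin n)}
    {i i' j j' : Fin n} (hne : R.Nonempty)
    (hR : ∀ r ∈ R, s(x, y) ∉ T.pathEdges (T.leaf r) x)
    (hi : s(x, y) ∉ T.pathEdges (T.leaf i) x) (hi' : s(x, y) ∉ T.pathEdges (T.leaf i') x)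
    (hj : s(x, y) ∉ T.pathEdges (T.leaf j) y) (hj' : s(x, y) ∉ T.pathEdges (T.leaf j') y)
    (huniq : ∀ f, f ∈ T.pathEdges (T.leaf i) (T.leaf j) →
      f ∈ T.pathEdges (T.leaf i') (T.leaf j') → f = s(x, y)) :
    T.crossDiff R i i' j j' = - T.w s(x, y) := by
  classical
  have := T.fintypeV
  rw [crossDiff_eq_sum, Finset.sum_eq_single s(x, y)]
  · obtain ⟨r, hr⟩ := hne
    have h₁ : s(x, y) ∉ T.subtreeEdges (insert i (insert i' (R : Set (Fin n)))) := by
      have key : ∀ a ∈ insert i (insert i' (R : Set (Fin n))),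
          s(x, y) ∉ T.pathEdges (T.leaf a) x := by
        rintro a (rfl | rfl | ha)
        exacts [hi, hi', hR a ha]
      rintro ⟨a, ha, b, hb, hab⟩
      exact notMem_pathEdges_trans (key a ha) (notMem_pathEdges_symm (key b hb)) hab
    have h₂ : s(x, y) ∈ T.subtreeEdges (insert j (insert j' (R : Set (Fin n)))) :=
      ⟨r, by simp [hr], j, by simp, mem_pathEdges_of_sides hxy (hR r hr) hj⟩
    have h₃ : s(x, y) ∈ T.subtreeEdges (insert i (insert j' (R : Set (Fin n)))) :=
      ⟨i, by simp, j', by simp, mem_pathEdges_of_sides hxy hi hj'⟩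
    have h₄ : s(x, y) ∈ T.subtreeEdges (insert j (insert i' (R : Set (Fin n)))) :=
      ⟨i', by simp, j, by simp, mem_pathEdges_of_sides hxy hi' hj⟩
    rw [if_neg h₁, if_pos h₂, if_pos h₃, if_pos h₄]
    ring
  · exact fun e _ he => cross_eq_zero
      (imp_iff_not_or.1 fun h h' => he (huniq e h h'))
  · exact fun h => absurd (Finset.mem_univ _) h

lemma crossDiff_eq_neg_weight_of_between {x y : T.V} (hxy : T.G.Adj x y) {R : Finset (Fin n)}
    {i i' j j' : Fin n} (hne : R.Nonempty)
    (hR : (∀ r ∈ R, s(x, y) ∉ T.pathEdges (T.leaf r) x) ∨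
      ∀ r ∈ R, s(x, y) ∉ T.pathEdges (T.leaf r) y)
    (hi : s(x, y) ∉ T.pathEdges (T.leaf i) x) (hi' : s(x, y) ∉ T.pathEdges (T.leaf i') x)
    (hj : s(x, y) ∉ T.pathEdges (T.leaf j) y) (hj' : s(x, y) ∉ T.pathEdges (T.leaf j') y)
    (hx : ∀ f, f ∉ T.pathEdges (T.leaf i) x ∨ f ∉ T.pathEdges (T.leaf i') x)
    (hy : ∀ f, f ∉ T.pathEdges (T.leaf j) y ∨ f ∉ T.pathEdges (T.leaf j') y) :
    T.crossDiff R i i' j j' = - T.w s(x, y) := by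
  rcases hR with hR | hR
  · exact crossDiff_eq_neg_weight hxy hne hR hi hi' hj hj'
      fun f => eq_of_mem_pathEdges_cross hxy hi hi' hj hj' hx hy
  · rw [crossDiff_comm, Sym2.eq_swap]
    rw [Sym2.eq_swap] at hR hi hi' hj hj'
    exact crossDiff_eq_neg_weight hxy.symm hne hR hj hj' hi hi'
      fun f => eq_of_mem_pathEdges_cross hxy.symm hj hj' hi hi' hy hx

end CrossDiff

lemma Realizes.crossDiff_eq {T T' : WTree n} {k : ℕ} {D₀ : Finset (Fin n) → ℝ}
    (hT : T.Realizes k D₀) (hT' : T'.Realizes k D₀) {R : Finset (Fin n)} (hR : R.card + 2 = k)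
    {i i' j j' : Fin n} (hiR : i ∉ R) (hi'R : i' ∉ R) (hjR : j ∉ R) (hj'R : j' ∉ R)
    (hii' : i ≠ i') (hjj' : j ≠ j') (hij' : i ≠ j') (hji' : j ≠ i') :
    T.crossDiff R i i' j j' = T'.crossDiff R i i' j j' := by
  have key : ∀ a b, a ∉ R → b ∉ R → a ≠ b →
      T.D (insert a (insert b R)) = T'.D (insert a (insert b R)) := by
    intro a b ha hb hab
    have hcard : (insert a (insert b R)).card = k := by
      rw [Finset.card_insert_of_notMem (by simp [hab, ha]), Finset.card_insert_of_notMem hb, hR]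
    rw [hT _ hcard, hT' _ hcard]
  unfold crossDiff
  rw [key i i' hiR hi'R hii', key j j' hjR hj'R hjj', key i j' hiR hj'R hij',
    key j i' hjR hi'R hji']

/-- If `f` and `f'` witness that the two ways of crossing `i, i'` with `j, j'` have nontrivial
common paths, the quartet is resolved as `⟨i, i' | j, j'⟩`. -/
lemma buneman_of_mem_of_mem {T : WTree n} {i i' j j' : Fin n} {f f' : Sym2 T.V}
    (hf : f ∈ T.pathEdges (T.leaf i) (T.leaf j)) (hf' : f ∈ T.pathEdges (T.leaf i') (T.leaf j'))
    (hg : f' ∈ T.pathEdges (T.leaf i) (T.leaf j'))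
    (hg' : f' ∈ T.pathEdges (T.leaf i') (T.leaf j)) : T.Buneman i i' j j' := by
  have hf'' : f ∈ T.pathEdges (T.leaf j) (T.leaf i) := by
    by_contra h
    exact notMem_pathEdges_symm h hf
  by_cases h : f ∈ T.pathEdges (T.leaf i) (T.leaf i')
  · exact absurd hg' (notMem_pathEdges_of_separates (notMem_pathEdges_of_mem_of_mem h hf')
      (notMem_pathEdges_symm (notMem_pathEdges_of_mem_of_mem hf'' h)) h hg)
  · refine buneman_of_separates h ?_ hf
    have : f ∈ T.pathEdges (T.leaf i) (T.leaf j') := by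
      by_contra h'
      exact notMem_pathEdges_trans (notMem_pathEdges_symm h) h' hf'
    exact notMem_pathEdges_of_mem_of_mem hf'' this

/-- A large side of an edge contains `k - 2` leaves away from two given ones. -/
lemma exists_finset_of_le_ncard_sideLeaves {T : WTree n} {k : ℕ} {e : Sym2 T.V} {x : T.V}
    (h : k ≤ (T.sideLeaves e x).ncard) (i i' : Fin n) :
    ∃ R : Finset (Fin n), R.card = k - 2 ∧ i ∉ R ∧ i' ∉ R ∧
      ∀ r ∈ R, e ∉ T.pathEdges (T.leaf r) x := by
  classical
  rw [Set.ncard_eq_toFinset_card'] at h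
  have h₁ : k - 2 ≤ ((T.sideLeaves e x).toFinset \ {i, i'}).card := by
    have := Finset.le_card_sdiff {i, i'} (T.sideLeaves e x).toFinset
    have := Finset.card_le_two (a := i) (b := i')
    omega
  obtain ⟨R, hR, hcard⟩ := Finset.exists_subset_card_eq h₁
  refine ⟨R, hcard, fun hi => ?_, fun hi => ?_, fun r hr => ?_⟩
  · simpa using hR hi
  · simpa using hR hi
  · have := hR hr
    simp only [Finset.mem_sdiff, Set.mem_toFinset] at this
    exact this.1

lemma buneman_of_between {P P' : WTree n} {k : ℕ} (hk : 3 ≤ k) {D₀ : Finset (Fin n) → ℝ}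
    (hps : P.IsPseudostar k) (hP : P.Realizes k D₀) (hP' : P'.Realizes k D₀) {x y : P.V}
    (hxy : P.G.Adj x y) (hw : P.w s(x, y) ≠ 0) {i i' j j' : Fin n}
    (hii' : i ≠ i') (hjj' : j ≠ j')
    (hi : s(x, y) ∉ P.pathEdges (P.leaf i) x) (hi' : s(x, y) ∉ P.pathEdges (P.leaf i') x)
    (hj : s(x, y) ∉ P.pathEdges (P.leaf j) y) (hj' : s(x, y) ∉ P.pathEdges (P.leaf j') y)
    (hx : ∀ f, f ∉ P.pathEdges (P.leaf i) x ∨ f ∉ P.pathEdges (P.leaf i') x)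
    (hy : ∀ f, f ∉ P.pathEdges (P.leaf j) y ∨ f ∉ P.pathEdges (P.leaf j') y) :
    P'.Buneman i i' j j' := by
  have hne : ∀ a b, s(x, y) ∉ P.pathEdges (P.leaf a) x → s(x, y) ∉ P.pathEdges (P.leaf b) y →
      a ≠ b := by
    rintro a _ ha hb rfl
    exact notMem_pathEdges_self _ _ (mem_pathEdges_of_sides hxy ha hb)
  obtain ⟨R, hcard, hiR, hi'R, hjR, hj'R, hR⟩ : ∃ R : Finset (Fin n), R.card = k - 2 ∧
      i ∉ R ∧ i' ∉ R ∧ j ∉ R ∧ j' ∉ R ∧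
      ((∀ r ∈ R, s(x, y) ∉ P.pathEdges (P.leaf r) x) ∨
        ∀ r ∈ R, s(x, y) ∉ P.pathEdges (P.leaf r) y) := by
    rcases hps x y hxy with h | h
    · obtain ⟨R, hcard, hiR, hi'R, hR⟩ := exists_finset_of_le_ncard_sideLeaves h i i'
      exact ⟨R, hcard, hiR, hi'R, fun h' => hne j j (hR j h') hj rfl,
        fun h' => hne j' j' (hR j' h') hj' rfl, .inl hR⟩
    · obtain ⟨R, hcard, hjR, hj'R, hR⟩ := exists_finset_of_le_ncard_sideLeaves h j j'
      exact ⟨R, hcard, fun h' => hne i i hi (hR i h') rfl,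
        fun h' => hne i' i' hi' (hR i' h') rfl, hjR, hj'R, .inr hR⟩
  have hRne : R.Nonempty := Finset.card_pos.1 (by omega)
  have hRk : R.card + 2 = k := by omega
  have h₁ : P'.crossDiff R i i' j j' ≠ 0 := by
    rw [← hP.crossDiff_eq hP' hRk hiR hi'R hjR hj'R hii' hjj' (hne _ _ hi hj')
      (hne _ _ hi' hj).symm, crossDiff_eq_neg_weight_of_between hxy hRne hR hi hi' hj hj' hx hy]
    exact neg_ne_zero.2 hw
  have h₂ : P'.crossDiff R i i' j' j ≠ 0 := by
    rw [← hP.crossDiff_eq hP' hRk hiR hi'R hj'R hjR hii' hjj'.symm (hne _ _ hi hj)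
      (hne _ _ hi' hj').symm, crossDiff_eq_neg_weight_of_between hxy hRne hR hi hi' hj' hj hx
      fun f => (hy f).symm]
    exact neg_ne_zero.2 hw
  obtain ⟨f, hf, hf'⟩ := exists_mem_of_crossDiff_ne_zero h₁
  obtain ⟨g, hg, hg'⟩ := exists_mem_of_crossDiff_ne_zero h₂
  exact buneman_of_mem_of_mem hf hf' hg hg'

lemma Buneman.of_realizes {P P' : WTree n} {k : ℕ} (hk : 3 ≤ k) {D₀ : Finset (Fin n) → ℝ}
    (hnz : P.InternalNonzero) (hess : P.Essential) (hps : P.IsPseudostar k)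
    (hP : P.Realizes k D₀) (hP' : P'.Realizes k D₀) {i i' j j' : Fin n}
    (hii' : i ≠ i') (hjj' : j ≠ j') (h : P.Buneman i i' j j') : P'.Buneman i i' j j' := by
  obtain ⟨x, y, hxy, hi, hi', hj, hj'⟩ := h.exists_adj
  have hxnode := isNode_of_two_leaves hess hxy hii' hi hi'
  have hynode : P.IsNode y := by
    rw [Sym2.eq_swap] at hj hj'
    exact isNode_of_two_leaves hess hxy.symm hjj' hj hj'
  have hw := hnz.weight_ne_zero hxy hxnode hynode
  have hstep : ∀ b b', b ≠ b' → s(x, y) ∉ P.pathEdges (P.leaf b) y →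
      s(x, y) ∉ P.pathEdges (P.leaf b') y →
      (∀ f, f ∉ P.pathEdges (P.leaf b) y ∨ f ∉ P.pathEdges (P.leaf b') y) →
      P'.Buneman i i' b b' := by
    intro b b' hbb' hb hb' hy
    rcases between_or_exists_between hxnode y i i' with hx | ⟨a, hia, hi'a, ha, hx, hx'⟩
    · exact buneman_of_between hk hps hP hP' hxy hw hii' hbb' hi hi' hb hb' hx hy
    · exact (buneman_of_between hk hps hP hP' hxy hw hia hbb' hi ha hb hb' hx hy).trans
        (buneman_of_between hk hps hP hP' hxy hw hi'a hbb' hi' ha hb hb' hx' hy)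
  rcases between_or_exists_between hynode x j j' with hy | ⟨b, hjb, hj'b, hb, hy, hy'⟩
  · exact hstep j j' hjj' hj hj' hy
  · rw [Sym2.eq_swap] at hb
    exact ((hstep j b hjb hj hb hy).symm.trans (hstep j' b hj'b hj' hb hy').symm).symm

end WTree

/-- if `3 ≤ k ≤ n-2` and two internal-nonzero-weighted essential pseudostars
of kind `(n,k)` with leaf set `[n]` realize the same family `{D_I}` indexed by the
`k`-subsets of `[n]`, then they have the same Buneman indices. -/
theorem statement9 (n k : ℕ) (h3 : 3 ≤ k) (hk : k ≤ n - 2)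
    (D₀ : Finset (Fin n) → ℝ)
    (P P' : WTree n)
    (hP : P.InternalNonzero ∧ P.Essential ∧ P.IsPseudostar k ∧ P.Realizes k D₀)
    (hP' : P'.InternalNonzero ∧ P'.Essential ∧ P'.IsPseudostar k ∧ P'.Realizes k D₀)
    (i j l m : Fin n) (hcard : ({i, j, l, m} : Finset (Fin n)).card = 4) :
    (P.Buneman i j l m ↔ P'.Buneman i j l m) := by
  have hij : i ≠ j := by
    rintro rfl
    rw [Finset.insert_eq_of_mem (by simp)] at hcard
    exact absurd (Finset.card_le_three (a := i) (b := l) (c := m)) (by omega)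
  have hlm : l ≠ m := by
    rintro rfl
    rw [Finset.pair_eq_singleton] at hcard
    exact absurd (Finset.card_le_three (a := i) (b := j) (c := l)) (by omega)
  obtain ⟨hnz, hess, hps, hr⟩ := hP
  obtain ⟨hnz', hess', hps', hr'⟩ := hP'
  exact ⟨fun h => h.of_realizes h3 hnz hess hps hr hr' hij hlm,
    fun h => h.of_realizes h3 hnz' hess' hps' hr' hr hij hlm⟩
end

section
/- Let n, k ∈ ℕ with 3 ≤ k ≤ n−1, let {D_I}, indexed by the k-subsets I of [n], be an l-treelike family of real numbers, and let U be the set of weighted trees with leaf set [n] realizing the family. If every element of U is a pseudostar of kind (n,k), then all elements of U have the same total weight: D_tot(𝒫) = D_tot(𝒫′) for all 𝒫, 𝒫′ ∈ U. -/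
section SubsetSums

variable {α : Type*} [DecidableEq α]

/-- The sum of `h` over the sets between `A` and `A ∪ R`. -/
def intervalSum (h : Finset α → ℝ) (R A : Finset α) : ℝ := ∑ S ∈ R.powerset, h (A ∪ S)

lemma intervalSum_insert (h : Finset α → ℝ) {R : Finset α} {i : α} (hi : i ∉ R) (A : Finset α) :
    intervalSum h (insert i R) A = intervalSum h R A + intervalSum h R (insert i A) := by
  unfold intervalSum
  rw [Finset.sum_powerset_insert hi]
  simp [Finset.union_insert, Finset.insert_union]

@[simp] lemma intervalSum_empty_left (h : Finset α → ℝ) (A : Finset α) :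
    intervalSum h ∅ A = h A := by
  simp [intervalSum]

lemma intervalSum_empty_right (h : Finset α → ℝ) (R : Finset α) :
    intervalSum h R ∅ = ∑ A ∈ R.powerset, h A := by
  simp [intervalSum]

/-- No two members of `F` cross: one of the four corners of any pair of members is empty. -/
def NonCrossing (F : Finset α → Prop) : Prop :=
  ∀ A B, F A → F B → ∀ a b c d, a ∈ A → b ∈ A → c ∉ A → d ∉ A →
    a ∈ B → b ∉ B → c ∈ B → d ∉ B → False

/-- Some member of `F` has the two-element trace `{x, y}` on the complement of `R`. -/
def HasTrace (F : Finset α → Prop) (R : Finset α) (x y : α) : Prop :=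
  x ∉ R ∧ y ∉ R ∧ x ≠ y ∧ ∃ S ⊆ R, F ({x, y} ∪ S)

lemma HasTrace.symm {F : Finset α → Prop} {R : Finset α} {x y : α} (hxy : HasTrace F R x y) :
    HasTrace F R y x := by
  obtain ⟨hx, hy, hne, S, hS, hF⟩ := hxy
  exact ⟨hy, hx, hne.symm, S, hS, by rwa [Finset.pair_comm]⟩

lemma NonCrossing.hasTrace_unique [Fintype α] {F : Finset α → Prop} (hF : NonCrossing F)
    {R : Finset α} (hR : R.card + 4 ≤ Fintype.card α) {x y z : α}
    (h1 : HasTrace F R x y) (h2 : HasTrace F R x z) : y = z := by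
  by_contra hyz
  obtain ⟨hx, hy, hxy, S, hS, h1⟩ := h1
  obtain ⟨-, hz, hxz, S', hS', h2⟩ := h2
  obtain ⟨d, -, hd⟩ : ∃ d ∈ Finset.univ, d ∉ R ∪ {x, y, z} := by
    refine Finset.exists_mem_notMem_of_card_lt_card ?_
    have := Finset.card_union_le R {x, y, z}
    have := Finset.card_le_three (a := x) (b := y) (c := z)
    rw [Finset.card_univ]
    omega
  simp only [Finset.mem_union, Finset.mem_insert, Finset.mem_singleton, not_or] at hd
  have key : ∀ {v : α}, v ∉ R → v ∉ S ∧ v ∉ S' :=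
    fun hv => ⟨fun h => hv (hS h), fun h => hv (hS' h)⟩
  have := key hx; have := key hy; have := key hz; have := key hd.1
  refine hF _ _ h1 h2 x y z d ?_ ?_ ?_ ?_ ?_ ?_ ?_ ?_ <;> simp <;> grind

end SubsetSums

section Matchings

variable {α : Type*} {m₁ m₂ : α → α → Prop}

/-- The graph of a partial matching: a symmetric relation with at most one partner per element. -/
def IsMatchingRel (m : α → α → Prop) : Prop :=
  (∀ x y, m x y → m y x) ∧ ∀ x y z, m x y → m x z → y = z

/-- Three elements, pairwise unrelated. -/
def HasIndepTriple (e : α → α → Prop) (M : Finset α) : Prop :=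
  ∃ x ∈ M, ∃ y ∈ M, ∃ z ∈ M, x ≠ y ∧ x ≠ z ∧ y ≠ z ∧ ¬ e x y ∧ ¬ e x z ∧ ¬ e y z

/-- An element has at most two neighbours in the union of two matchings. -/
lemma exists_nonadjacent_of_matchings (h₁ : IsMatchingRel m₁) (h₂ : IsMatchingRel m₂) (x : α)
    {y z w : α} (hyz : y ≠ z) (hyw : y ≠ w) (hzw : z ≠ w) :
    ¬ (m₁ x y ∨ m₂ x y) ∨ ¬ (m₁ x z ∨ m₂ x z) ∨ ¬ (m₁ x w ∨ m₂ x w) := by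
  obtain ⟨-, u₁⟩ := h₁
  obtain ⟨-, u₂⟩ := h₂
  grind

/-- The union of two matchings contains no triangle. -/
lemma exists_nonadjacent_pair_of_matchings (h₁ : IsMatchingRel m₁) (h₂ : IsMatchingRel m₂)
    {y z w : α} (hyz : y ≠ z) (hyw : y ≠ w) (hzw : z ≠ w) :
    ¬ (m₁ y z ∨ m₂ y z) ∨ ¬ (m₁ y w ∨ m₂ y w) ∨ ¬ (m₁ z w ∨ m₂ z w) := by
  obtain ⟨s₁, u₁⟩ := h₁
  obtain ⟨s₂, u₂⟩ := h₂
  grind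

lemma hasIndepTriple_of_three_nonadjacent (h₁ : IsMatchingRel m₁) (h₂ : IsMatchingRel m₂)
    {M : Finset α} {x y z w : α} (hx : x ∈ M) (hy : y ∈ M) (hz : z ∈ M) (hw : w ∈ M)
    (hxy : x ≠ y) (hxz : x ≠ z) (hxw : x ≠ w) (hyz : y ≠ z) (hyw : y ≠ w) (hzw : z ≠ w)
    (n1 : ¬ (m₁ x y ∨ m₂ x y)) (n2 : ¬ (m₁ x z ∨ m₂ x z)) (n3 : ¬ (m₁ x w ∨ m₂ x w)) :
    HasIndepTriple (fun a b => m₁ a b ∨ m₂ a b) M := by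
  rcases exists_nonadjacent_pair_of_matchings h₁ h₂ hyz hyw hzw with c | c | c
  · exact ⟨x, hx, y, hy, z, hz, hxy, hxz, hyz, n1, n2, c⟩
  · exact ⟨x, hx, y, hy, w, hw, hxy, hxw, hyw, n1, n3, c⟩
  · exact ⟨x, hx, z, hz, w, hw, hxz, hxw, hzw, n2, n3, c⟩

lemma hasIndepTriple_of_unmatched (h₁ : IsMatchingRel m₁) (h₂ : IsMatchingRel m₂)
    {M : Finset α} {x y z v w : α} (hx : x ∈ M) (hy : y ∈ M) (hz : z ∈ M) (hv : v ∈ M)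
    (hw : w ∈ M) (hxy : x ≠ y) (hxz : x ≠ z) (hxv : x ≠ v) (hxw : x ≠ w) (hyz : y ≠ z)
    (hyv : y ≠ v) (hyw : y ≠ w) (hzv : z ≠ v) (hzw : z ≠ w) (hvw : v ≠ w)
    (n1 : ¬ m₁ x y) (n2 : ¬ m₁ x z) (n3 : ¬ m₁ x v) (n4 : ¬ m₁ x w) :
    HasIndepTriple (fun a b => m₁ a b ∨ m₂ a b) M := by
  have u : ∀ a b, m₂ x a → m₂ x b → a = b := h₂.2 x
  have T := fun {a b c : α} => @hasIndepTriple_of_three_nonadjacent α m₁ m₂ h₁ h₂ M x a b c hx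
  by_cases c1 : m₂ x y
  · refine T hz hv hw hxz hxv hxw hzv hzw hvw ?_ ?_ ?_ <;> rintro (h | h) <;> tauto
  by_cases c2 : m₂ x z
  · refine T hy hv hw hxy hxv hxw hyv hyw hvw ?_ ?_ ?_ <;> rintro (h | h) <;> tauto
  by_cases c3 : m₂ x v
  · refine T hy hz hw hxy hxz hxw hyz hyw hzw ?_ ?_ ?_ <;> rintro (h | h) <;> tauto
  refine T hy hz hv hxy hxz hxv hyz hyv hzv ?_ ?_ ?_ <;> rintro (h | h) <;> tauto

lemma hasIndepTriple_of_matchings [DecidableEq α] (h₁ : IsMatchingRel m₁)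
    (h₂ : IsMatchingRel m₂) {M : Finset α} (hM : 5 ≤ M.card) :
    HasIndepTriple (fun a b => m₁ a b ∨ m₂ a b) M := by
  obtain ⟨N, hNM, hN⟩ := Finset.exists_subset_card_eq hM
  obtain ⟨x, N', hxN, rfl, hN'⟩ := Finset.card_eq_succ.1 hN
  obtain ⟨y, N'', hyN, rfl, hN''⟩ := Finset.card_eq_succ.1 hN'
  obtain ⟨z, v, w, hzv, hzw, hvw, rfl⟩ := Finset.card_eq_three.1 hN''
  simp only [Finset.mem_insert, Finset.mem_singleton, not_or, ← ne_eq] at hxN hyN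
  obtain ⟨hxy, hxz, hxv, hxw⟩ := hxN
  obtain ⟨hyz, hyv, hyw⟩ := hyN
  have hx : x ∈ M := hNM (by simp)
  have hy : y ∈ M := hNM (by simp)
  have hz : z ∈ M := hNM (by simp)
  have hv : v ∈ M := hNM (by simp)
  have hw : w ∈ M := hNM (by simp)
  by_contra hno
  have T := fun {a b c d e : α} ha hb hc hd he h1 h2 h3 h4 h5 h6 h7 h8 h9 h10 n1 n2 n3 n4 =>
    hno (@hasIndepTriple_of_unmatched α m₁ m₂ h₁ h₂ M a b c d e ha hb hc hd he h1 h2 h3 h4 h5 h6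
      h7 h8 h9 h10 n1 n2 n3 n4)
  have sx : m₁ x y ∨ m₁ x z ∨ m₁ x v ∨ m₁ x w := by
    by_contra! hc
    exact T hx hy hz hv hw hxy hxz hxv hxw hyz hyv hyw hzv hzw hvw
      hc.1 hc.2.1 hc.2.2.1 hc.2.2.2
  have sy : m₁ y x ∨ m₁ y z ∨ m₁ y v ∨ m₁ y w := by
    by_contra! hc
    exact T hy hx hz hv hw hxy.symm hyz hyv hyw hxz hxv hxw hzv hzw hvw
      hc.1 hc.2.1 hc.2.2.1 hc.2.2.2
  have sz : m₁ z x ∨ m₁ z y ∨ m₁ z v ∨ m₁ z w := by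
    by_contra! hc
    exact T hz hx hy hv hw hxz.symm hyz.symm hzv hzw hxy hxv hxw hyv hyw hvw
      hc.1 hc.2.1 hc.2.2.1 hc.2.2.2
  have sv : m₁ v x ∨ m₁ v y ∨ m₁ v z ∨ m₁ v w := by
    by_contra! hc
    exact T hv hx hy hz hw hxv.symm hyv.symm hzv.symm hvw hxy hxz hxw hyz hyw hzw
      hc.1 hc.2.1 hc.2.2.1 hc.2.2.2
  have sw : m₁ w x ∨ m₁ w y ∨ m₁ w z ∨ m₁ w v := by
    by_contra! hc
    exact T hw hx hy hz hv hxw.symm hyw.symm hzw.symm hvw.symm hxy hxz hxv hyz hyv hzv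
      hc.1 hc.2.1 hc.2.2.1 hc.2.2.2
  obtain ⟨s₁, u₁⟩ := h₁
  clear T hno h₂ hN hN' hN'' hNM hx hy hz hv hw hM
  grind

end Matchings

section SubsetSums

variable {α : Type*} [DecidableEq α]

lemma intervalSum_pair_eq_zero {F₁ F₂ : Finset α → Prop} {h : Finset α → ℝ}
    (hs : ∀ A, h A ≠ 0 → F₁ A ∨ F₂ A) {R : Finset α} {a b : α} (ha : a ∉ R) (hb : b ∉ R)
    (hne : a ≠ b) (hab : ¬ (HasTrace F₁ R a b ∨ HasTrace F₂ R a b)) :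
    intervalSum h R {a, b} = 0 := by
  refine Finset.sum_eq_zero fun S hS => ?_
  by_contra h0
  rw [Finset.mem_powerset] at hS
  exact hab ((hs _ h0).imp (fun h => ⟨ha, hb, hne, S, hS, h⟩) (fun h => ⟨ha, hb, hne, S, hS, h⟩))

lemma eq_zero_of_sum_powerset_eq_sum_singletons {h : Finset α → ℝ} (h0 : h ∅ = 0) {c : ℕ}
    (hJ : ∀ J : Finset α, J.card ≤ c → intervalSum h J ∅ = ∑ a ∈ J, h {a}) (A : Finset α)
    (hA : A.card ≤ c) (hA1 : A.card ≠ 1) : h A = 0 := by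
  induction A using Finset.strongInduction with
  | H A ih =>
    rcases A.eq_empty_or_nonempty with rfl | hne
    · exact h0
    have hsub : A.powerset = insert A (A.powerset.erase A) := by simp
    have h1 := hJ A hA
    rw [intervalSum_empty_right, hsub, Finset.sum_insert (by simp)] at h1
    have h2 : ∑ B ∈ A.powerset.erase A, h B = ∑ a ∈ A, h {a} := by
      rw [← Finset.sum_image (s := A) (g := fun a => ({a} : Finset α)) (f := h) (by simp)]
      symm
      refine Finset.sum_subset ?_ ?_
      · intro B hB
        obtain ⟨a, ha, rfl⟩ := Finset.mem_image.1 hB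
        simp only [Finset.mem_erase, Finset.mem_powerset, Finset.singleton_subset_iff]
        refine ⟨?_, ha⟩
        rintro rfl
        simp at hA1
      · intro B hB hB'
        simp only [Finset.mem_erase, Finset.mem_powerset] at hB
        refine ih B (lt_of_le_of_ne hB.2 hB.1) ((Finset.card_le_card hB.2).trans hA) ?_
        intro hB1
        obtain ⟨a, rfl⟩ := Finset.card_eq_one.1 hB1
        exact hB' (Finset.mem_image.2 ⟨a, Finset.singleton_subset_iff.1 hB.2, rfl⟩)
    linarith

variable [Fintype α]

lemma NonCrossing.isMatchingRel_hasTrace {F : Finset α → Prop} (hF : NonCrossing F)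
    {R : Finset α} (hR : R.card + 4 ≤ Fintype.card α) : IsMatchingRel (HasTrace F R) :=
  ⟨fun _ _ h => h.symm, fun _ _ _ h1 h2 => hF.hasTrace_unique hR h1 h2⟩

/-- If the sum of `h` over the subsets of `J` depends only on `|J| = c`, then the interval sums of
`h` above the two-element sets vanish. -/
lemma intervalSum_pair_eq_zero_of_card_add_two {F₁ F₂ : Finset α → Prop} (hF₁ : NonCrossing F₁)
    (hF₂ : NonCrossing F₂) {h : Finset α → ℝ} (hs : ∀ A, h A ≠ 0 → F₁ A ∨ F₂ A) {c : ℕ} {t : ℝ}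
    (hc : c + 3 ≤ Fintype.card α) (ht : ∀ J : Finset α, J.card = c → intervalSum h J ∅ = t)
    {R : Finset α} (hR : R.card + 2 = c) {a b : α} (ha : a ∉ R) (hb : b ∉ R) (hab : a ≠ b) :
    intervalSum h R {a, b} = 0 := by
  have h₁ := hF₁.isMatchingRel_hasTrace (R := R) (by omega)
  have h₂ := hF₂.isMatchingRel_hasTrace (R := R) (by omega)
  have hM : 5 ≤ (Finset.univ \ R).card := by
    rw [Finset.card_univ_sdiff]; omega
  have key : ∀ a b, a ∉ R → b ∉ R → a ≠ b → intervalSum h R {a} + intervalSum h R {b} +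
      intervalSum h R {a, b} = t - intervalSum h R ∅ := by
    intro a b ha hb hab
    have hb' : b ∉ insert a R := by simp [hab.symm, hb]
    have := ht (insert b (insert a R)) (by
      rw [Finset.card_insert_of_notMem hb', Finset.card_insert_of_notMem ha]; omega)
    rw [intervalSum_insert h hb', intervalSum_insert h ha, intervalSum_insert h ha] at this
    simp only [insert_empty_eq] at this
    linarith
  have key' : ∀ a b, a ∉ R → b ∉ R → a ≠ b → ¬ (HasTrace F₁ R a b ∨ HasTrace F₂ R a b) →
      intervalSum h R {a} + intervalSum h R {b} = t - intervalSum h R ∅ := by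
    intro a b ha hb hab hn
    have := key a b ha hb hab
    rw [intervalSum_pair_eq_zero hs ha hb hab hn] at this
    linarith
  obtain ⟨x, hx, y, hy, z, hz, hxy, hxz, hyz, n1, n2, n3⟩ := hasIndepTriple_of_matchings h₁ h₂ hM
  simp only [Finset.mem_sdiff, Finset.mem_univ, true_and] at hx hy hz
  have e1 := key' x y hx hy hxy n1
  have e2 := key' x z hx hz hxz n2
  have e3 := key' y z hy hz hyz n3
  have half : ∀ v, v ∉ R → 2 * intervalSum h R {v} = t - intervalSum h R ∅ := by
    intro v hv
    by_cases vx : v = x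
    · subst vx; linarith
    by_cases vy : v = y
    · subst vy; linarith
    by_cases vz : v = z
    · subst vz; linarith
    rcases exists_nonadjacent_of_matchings h₁ h₂ v hxy hxz hyz with n | n | n
    · linarith [key' v x hv hx vx n]
    · linarith [key' v y hv hy vy n]
    · linarith [key' v z hv hz vz n]
  linarith [key a b ha hb hab, half a ha, half b hb]

lemma intervalSum_pair_eq_zero_of_card_le {F₁ F₂ : Finset α → Prop} (hF₁ : NonCrossing F₁)
    (hF₂ : NonCrossing F₂) {h : Finset α → ℝ} (hs : ∀ A, h A ≠ 0 → F₁ A ∨ F₂ A) {c : ℕ} {t : ℝ}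
    (hc : c + 3 ≤ Fintype.card α) (ht : ∀ J : Finset α, J.card = c → intervalSum h J ∅ = t)
    (d : ℕ) : ∀ R : Finset α, R.card + 2 + d = c → ∀ a b, a ∉ R → b ∉ R → a ≠ b →
      intervalSum h R {a, b} = 0 := by
  induction d with
  | zero =>
    intro R hR a b ha hb hab
    exact intervalSum_pair_eq_zero_of_card_add_two hF₁ hF₂ hs hc ht hR ha hb hab
  | succ d ih =>
    intro R hR a b ha hb hab
    have h₁ := hF₁.isMatchingRel_hasTrace (R := R) (by omega)
    have h₂ := hF₂.isMatchingRel_hasTrace (R := R) (by omega)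
    have step : ∀ x y z, x ∉ R → y ∉ R → z ∉ R → x ≠ y → x ≠ z → y ≠ z →
        intervalSum h R {x, y} = - intervalSum h R {z, x, y} := by
      intro x y z hx hy hz hxy hxz hyz
      have := ih (insert z R) (by rw [Finset.card_insert_of_notMem hz]; omega) x y
        (by simp [hxz, hx]) (by simp [hyz, hy]) hxy
      rw [intervalSum_insert h hz] at this
      linarith
    have hM : 2 < (Finset.univ \ (R ∪ {a, b})).card := by
      have := Finset.card_union_le R {a, b}
      rw [Finset.card_pair hab] at this
      rw [Finset.card_univ_sdiff]
      omega
    obtain ⟨x, y, z, hx, hy, hz, hxy, hxz, hyz⟩ := Finset.two_lt_card_iff.1 hM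
    simp only [Finset.mem_sdiff, Finset.mem_univ, Finset.mem_union, Finset.mem_insert,
      Finset.mem_singleton, true_and, not_or] at hx hy hz
    have swap : ∀ x, x ∉ R → x ≠ a → x ≠ b → intervalSum h R {a, b} = intervalSum h R {a, x} := by
      intro x hx hxa hxb
      rw [step a b x ha hb hx hab hxa.symm hxb.symm, step a x b ha hx hb hxa.symm hab hxb]
      congr 2
      ext; simp; tauto
    rcases exists_nonadjacent_of_matchings h₁ h₂ a hxy hxz hyz with n | n | n
    · rw [swap x hx.1 hx.2.1 hx.2.2]
      exact intervalSum_pair_eq_zero hs ha hx.1 (Ne.symm hx.2.1) n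
    · rw [swap y hy.1 hy.2.1 hy.2.2]
      exact intervalSum_pair_eq_zero hs ha hy.1 (Ne.symm hy.2.1) n
    · rw [swap z hz.1 hz.2.1 hz.2.2]
      exact intervalSum_pair_eq_zero hs ha hz.1 (Ne.symm hz.2.1) n

/-- Below the size `c`, the function `h` is supported on singletons. -/
lemma sum_powerset_eq_sum_singletons {F₁ F₂ : Finset α → Prop} (hF₁ : NonCrossing F₁)
    (hF₂ : NonCrossing F₂) {h : Finset α → ℝ} (h0 : h ∅ = 0)
    (hs : ∀ A, h A ≠ 0 → F₁ A ∨ F₂ A) {c : ℕ} {t : ℝ}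
    (hc : c + 3 ≤ Fintype.card α) (ht : ∀ J : Finset α, J.card = c → intervalSum h J ∅ = t)
    (J : Finset α) (hJ : J.card ≤ c) : intervalSum h J ∅ = ∑ a ∈ J, h {a} := by
  have single : ∀ (R : Finset α) (a : α), a ∉ R → R.card + 1 ≤ c →
      intervalSum h R {a} = h {a} := by
    intro R
    induction R using Finset.induction_on with
    | empty => simp
    | insert i R hi ih =>
      intro a ha hR
      rw [Finset.card_insert_of_notMem hi] at hR
      simp only [Finset.mem_insert, not_or] at ha
      rw [intervalSum_insert h hi, ih a ha.2 (by omega),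
        intervalSum_pair_eq_zero_of_card_le hF₁ hF₂ hs hc ht (c - (R.card + 2)) R (by omega) i a hi
          ha.2 (Ne.symm ha.1), add_zero]
  induction J using Finset.induction_on with
  | empty => simp [h0]
  | insert i R hi ih =>
    rw [Finset.card_insert_of_notMem hi] at hJ
    rw [intervalSum_insert h hi, Finset.sum_insert hi, ih (by omega), insert_empty_eq,
      single R i hi hJ, add_comm]

/-- A function on sets which is invariant under complement, supported on two non-crossing families
of sets one side of which has at most `c` elements, and whose sum over the subsets of `J` equals
half of its total sum for each `J` of size `c`, has total sum zero. -/
lemma sum_eq_zero_of_nonCrossing {F₁ F₂ : Finset α → Prop} (hF₁ : NonCrossing F₁)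
    (hF₂ : NonCrossing F₂) {h : Finset α → ℝ} (h0 : h ∅ = 0)
    (hs : ∀ A, h A ≠ 0 → F₁ A ∨ F₂ A) {c : ℕ} {t : ℝ} (hc1 : 1 ≤ c)
    (hc : c + 3 ≤ Fintype.card α)
    (ht : ∀ J : Finset α, J.card = c → ∑ A ∈ J.powerset, h A = t)
    (hcompl : ∀ A, h Aᶜ = h A) (hsmall : ∀ A, h A ≠ 0 → A.card ≤ c ∨ Aᶜ.card ≤ c)
    (htot : ∑ A, h A = 2 * t) : t = 0 := by
  simp_rw [← intervalSum_empty_right] at ht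
  have hJ := sum_powerset_eq_sum_singletons hF₁ hF₂ h0 hs hc ht
  have hvan := eq_zero_of_sum_powerset_eq_sum_singletons h0 hJ
  have hconst : ∀ a b, h {a} = h {b} := by
    intro a b
    rcases eq_or_ne a b with rfl | hab
    · rfl
    obtain ⟨R, hR, hRc⟩ := Finset.exists_subset_card_eq (s := Finset.univ \ {a, b}) (n := c - 1) (by
      rw [Finset.card_univ_sdiff, Finset.card_pair hab]; omega)
    have ha : a ∉ R := fun h => by simpa using hR h
    have hb : b ∉ R := fun h => by simpa using hR h
    have ca : (insert a R).card = c := by rw [Finset.card_insert_of_notMem ha]; omega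
    have cb : (insert b R).card = c := by rw [Finset.card_insert_of_notMem hb]; omega
    have e1 := (hJ _ ca.le).symm.trans (ht _ ca)
    have e2 := (hJ _ cb.le).symm.trans (ht _ cb)
    rw [Finset.sum_insert ha] at e1
    rw [Finset.sum_insert hb] at e2
    linarith
  have hpos : 0 < Fintype.card α := by omega
  obtain ⟨a⟩ := Fintype.card_pos_iff.1 hpos
  obtain ⟨J, -, hJc⟩ := Finset.exists_subset_card_eq (s := (Finset.univ : Finset α)) (n := c) (by
    rw [Finset.card_univ]; omega)
  have e1 := (hJ J hJc.le).symm.trans (ht J hJc)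
  rw [Finset.sum_congr rfl (fun b _ => hconst b a), Finset.sum_const, hJc, nsmul_eq_mul] at e1
  have e2 : ∑ A, h A = 2 * (Fintype.card α * h {a}) := by
    let I₁ : Finset (Finset α) := Finset.univ.image fun b => {b}
    let I₂ : Finset (Finset α) := Finset.univ.image fun b => {b}ᶜ
    have hdisj : Disjoint I₁ I₂ := by
      rw [Finset.disjoint_left]
      intro A h1 h2
      obtain ⟨b, -, rfl⟩ := Finset.mem_image.1 h1
      obtain ⟨b', -, h2⟩ := Finset.mem_image.1 h2
      have := congrArg Finset.card h2
      rw [Finset.card_compl, Finset.card_singleton, Finset.card_singleton] at this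
      omega
    have hsub : ∑ A ∈ I₁ ∪ I₂, h A = ∑ A, h A := by
      refine Finset.sum_subset (Finset.subset_univ _) ?_
      intro A _ hA
      by_contra hne
      simp only [I₁, I₂, Finset.mem_union, Finset.mem_image, Finset.mem_univ, true_and,
        not_or, not_exists] at hA
      rcases hsmall A hne with hsz | hsz
      · refine hne (hvan A hsz fun h1 => ?_)
        obtain ⟨b, rfl⟩ := Finset.card_eq_one.1 h1
        exact hA.1 b rfl
      · refine hne ((hcompl A).symm.trans (hvan Aᶜ hsz fun h1 => ?_))
        obtain ⟨b, hb⟩ := Finset.card_eq_one.1 h1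
        exact hA.2 b (by rw [← hb, compl_compl])
    rw [← hsub, Finset.sum_union hdisj, Finset.sum_image (by simp [Function.Injective]),
      Finset.sum_image (by simp [Function.Injective])]
    simp only [hcompl]
    rw [Finset.sum_congr rfl (fun b _ => hconst b a), Finset.sum_const, Finset.card_univ,
      nsmul_eq_mul]
    ring
  have hcn : (c : ℝ) + 3 ≤ Fintype.card α := by exact_mod_cast hc
  have hprod : ((Fintype.card α : ℝ) - c) * h {a} = 0 := by linarith
  rcases mul_eq_zero.1 hprod with hz | hz
  · linarith
  · rw [← e1, hz, mul_zero]

end SubsetSums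

section Trees

variable {V : Type*} {G : SimpleGraph V}

lemma SimpleGraph.IsTree.exists_isPath_mem_edges_iff (hG : G.IsTree) (e : Sym2 V) (u v : V) :
    (∃ p : G.Walk u v, p.IsPath ∧ e ∈ p.edges) ↔ ¬ (G.deleteEdges {e}).Reachable u v := by
  constructor
  · rintro ⟨p, hp, he⟩ hr
    obtain ⟨q, hq⟩ := hr.exists_isPath
    have hle : G.deleteEdges {e} ≤ G := SimpleGraph.deleteEdges_le _
    have hpq : p = q.mapLe hle :=
      (hG.existsUnique_path u v).unique hp (hq.mapLe hle)
    rw [hpq, SimpleGraph.Walk.edges_mapLe_eq_edges] at he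
    have := q.edges_subset_edgeSet he
    simp at this
  · intro hr
    obtain ⟨p, hp, -⟩ := hG.existsUnique_path u v
    refine ⟨p, hp, ?_⟩
    by_contra he
    exact hr ⟨p.toDeleteEdges {e} (fun e' he' => by
      rintro rfl
      exact he he')⟩

lemma SimpleGraph.Connected.reachable_deleteEdges_or (hG : G.Connected) (a b v : V) :
    (G.deleteEdges {s(a, b)}).Reachable v a ∨ (G.deleteEdges {s(a, b)}).Reachable v b := by
  suffices key : ∀ c, G.Walk v c → c = a → (G.deleteEdges {s(a, b)}).Reachable v a ∨
      (G.deleteEdges {s(a, b)}).Reachable v b from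
    (hG.preconnected v a).elim fun p => key a p rfl
  intro c p hc
  induction p with
  | nil => subst hc; exact Or.inl (SimpleGraph.Reachable.refl _)
  | @cons v u _ h p ih =>
    by_cases he : s(v, u) = s(a, b)
    · rcases Sym2.eq_iff.1 he with ⟨rfl, -⟩ | ⟨rfl, -⟩
      · exact Or.inl (SimpleGraph.Reachable.refl _)
      · exact Or.inr (SimpleGraph.Reachable.refl _)
    · have hadj : (G.deleteEdges {s(a, b)}).Adj v u := by simp [h, he]
      exact (ih hc).imp hadj.reachable.trans hadj.reachable.trans

lemma SimpleGraph.IsTree.not_reachable_deleteEdges (hG : G.IsTree) {a b : V} (h : G.Adj a b) :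
    ¬ (G.deleteEdges {s(a, b)}).Reachable a b :=
  SimpleGraph.isBridge_iff.1 (SimpleGraph.isAcyclic_iff_forall_adj_isBridge.1 hG.isAcyclic h)

/-- A walk avoiding `e` whose ends are separated by `e'` visits the ends of `e'`. -/
lemma SimpleGraph.reachable_of_separated {e : Sym2 V} {u v x y : V}
    (h : (G.deleteEdges {e}).Reachable u v) (h' : ¬ (G.deleteEdges {s(x, y)}).Reachable u v) :
    (G.deleteEdges {e}).Reachable u x := by
  obtain ⟨p⟩ := h
  by_cases hx : s(x, y) ∈ p.edges
  · classical
    exact ⟨p.takeUntil x (p.fst_mem_support_of_mem_edges hx)⟩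
  · refine absurd ⟨(p.mapLe (SimpleGraph.deleteEdges_le _)).toDeleteEdges {s(x, y)} ?_⟩ h'
    intro e' he'
    rw [SimpleGraph.Walk.edges_mapLe_eq_edges] at he'
    rintro rfl
    exact hx he'

/-- In a finite tree, each side of an edge contains a vertex of degree one. -/
lemma SimpleGraph.IsTree.exists_ncard_neighborSet_eq_one [Finite V] (hG : G.IsTree) {a b : V}
    (h : G.Adj a b) : ∃ v, (G.neighborSet v).ncard = 1 ∧
      (G.deleteEdges {s(a, b)}).Reachable v a := by
  classical
  have := Fintype.ofFinite V
  -- take a longest path starting with the edge from `b` to `a`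
  let P : ℕ → Prop := fun l => ∃ (v : V) (p : G.Walk a v), (p.cons h.symm).IsPath ∧ p.length = l
  have hP0 : P 0 := ⟨a, .nil, by simp [h.ne.symm], rfl⟩
  have hbound : ∀ l, P l → l ≤ Fintype.card V := by
    rintro l ⟨v, p, hp, rfl⟩
    exact hp.of_cons.length_lt.le
  obtain ⟨v, p, hp, hl⟩ := Nat.findGreatest_spec (P := P) (Nat.zero_le (Fintype.card V)) hP0
  have hmax : ∀ l, P l → l ≤ p.length := fun l hPl => by
    rw [hl]; exact Nat.le_findGreatest (hbound l hPl) hPl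
  refine ⟨v, ?_, ?_⟩
  · rw [Set.ncard_eq_one]
    refine ⟨(p.cons h.symm).penultimate, ?_⟩
    ext w
    simp only [SimpleGraph.mem_neighborSet, Set.mem_singleton_iff]
    constructor
    · intro hw
      refine hG.isAcyclic.eq_penultimate_of_adj_end hp hw ?_
      by_contra hns
      have hlong := hmax (p.length + 1) ⟨w, p.concat hw, by
        rw [← SimpleGraph.Walk.concat_cons]
        exact hp.concat hns hw, by simp⟩
      omega
    · rintro rfl
      exact ((p.cons h.symm).adj_penultimate (by simp)).symm
  · refine SimpleGraph.Reachable.symm ⟨p.toDeleteEdges {s(a, b)} ?_⟩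
    intro e' he'
    rintro rfl
    have := (SimpleGraph.Walk.cons_isPath_iff _ _).1 hp
    exact this.2 (p.snd_mem_support_of_mem_edges he')

lemma Sym2.sum_sum_mk_eq_two_mul_sum [Fintype V] [DecidableEq V] (f : Sym2 V → ℝ)
    (hf : ∀ e, e.IsDiag → f e = 0) : ∑ a, ∑ b, f s(a, b) = 2 * ∑ e, f e := by
  rw [← Fintype.sum_prod_type' (f := fun a b => f s(a, b)), Finset.mul_sum,
    ← Finset.sum_fiberwise (s := Finset.univ) (g := fun p : V × V => s(p.1, p.2))]
  refine Finset.sum_congr rfl fun e _ => ?_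
  rw [Finset.sum_congr rfl (g := fun _ => f e) (fun p hp => by rw [(Finset.mem_filter.1 hp).2]),
    Finset.sum_const, nsmul_eq_mul]
  induction e with
  | h x y =>
    by_cases hxy : x = y
    · rw [hf s(x, y) (by simpa using hxy)]; simp
    · have : (Finset.univ.filter fun p : V × V => s(p.1, p.2) = s(x, y)) = {(x, y), (y, x)} := by
        ext ⟨a, b⟩; simp
      rw [this, Finset.card_pair (by simp [hxy])]
      norm_num

end Trees

namespace WTree

variable {n : ℕ}

attribute [local instance] WTree.fintypeV

open Classical in
/-- The leaves on the side of `a` when the edge `s(a, b)` is removed. -/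
noncomputable def side (T : WTree n) (a b : T.V) : Finset (Fin n) :=
  Finset.univ.filter fun i => (T.G.deleteEdges {s(a, b)}).Reachable (T.leaf i) a

/-- The leaf sets cut off by an edge. -/
def IsSide (T : WTree n) (A : Finset (Fin n)) : Prop :=
  ∃ a b : T.V, T.G.Adj a b ∧ T.side a b = A

open Classical in
/-- The total weight of the (oriented) edges cutting off the leaf set `A`. -/
noncomputable def splitWeight (T : WTree n) (A : Finset (Fin n)) : ℝ :=
  ∑ a, ∑ b, if T.side a b = A then T.w s(a, b) else 0

lemma mem_side {T : WTree n} {a b : T.V} {i : Fin n} :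
    i ∈ T.side a b ↔ (T.G.deleteEdges {s(a, b)}).Reachable (T.leaf i) a := by
  simp [side]

lemma coe_side (T : WTree n) (a b : T.V) : (T.side a b : Set (Fin n)) = T.sideLeaves s(a, b) a := by
  ext i
  simp only [Finset.mem_coe, mem_side, sideLeaves, pathEdges, Set.mem_ofPred_eq,
    T.isTree.exists_isPath_mem_edges_iff, not_not]

lemma side_swap {T : WTree n} {a b : T.V} (h : T.G.Adj a b) : T.side b a = (T.side a b)ᶜ := by
  ext i
  rw [Finset.mem_compl, mem_side, mem_side, Sym2.eq_swap (a := b)]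
  constructor
  · intro hb ha
    exact T.isTree.not_reachable_deleteEdges h (ha.symm.trans hb)
  · intro ha
    exact (T.isTree.connected.reachable_deleteEdges_or a b (T.leaf i)).resolve_left ha

lemma side_nonempty {T : WTree n} {a b : T.V} (h : T.G.Adj a b) : (T.side a b).Nonempty := by
  obtain ⟨v, hv, hr⟩ := T.isTree.exists_ncard_neighborSet_eq_one h
  obtain ⟨i, rfl⟩ := (T.leafSpec v).1 hv
  exact ⟨i, mem_side.2 hr⟩

lemma reachable_iff_mem_side_iff {T : WTree n} {a b : T.V} (h : T.G.Adj a b) (i j : Fin n) :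
    (T.G.deleteEdges {s(a, b)}).Reachable (T.leaf i) (T.leaf j) ↔
      (i ∈ T.side a b ↔ j ∈ T.side a b) := by
  constructor
  · intro hr
    rw [mem_side, mem_side]
    exact ⟨hr.symm.trans, hr.trans⟩
  · intro hij
    by_cases hi : i ∈ T.side a b
    · exact (mem_side.1 hi).trans (mem_side.1 (hij.1 hi)).symm
    · have hj : j ∉ T.side a b := fun hj => hi (hij.2 hj)
      rw [← Finset.mem_compl, ← side_swap h, mem_side, Sym2.eq_swap] at hi hj
      exact hi.trans hj.symm

lemma nonCrossing_isSide (T : WTree n) : NonCrossing T.IsSide := by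
  rintro _ _ ⟨x, y, hxy, rfl⟩ ⟨x', y', hxy', rfl⟩ a b c d ha hb hc hd ha' hb' hc' hd'
  have r := reachable_iff_mem_side_iff hxy
  have r' := reachable_iff_mem_side_iff hxy'
  have h1 := SimpleGraph.reachable_of_separated ((r a b).2 (by tauto)) (fun h => by
    have := (r' a b).1 h; tauto)
  have h2 := SimpleGraph.reachable_of_separated ((r c d).2 (by tauto)) (fun h => by
    have := (r' c d).1 h; tauto)
  have := (r a c).1 (h1.trans h2.symm)
  tauto

lemma w_eq_zero_of_not_adj {T : WTree n} {a b : T.V} (h : ¬ T.G.Adj a b) : T.w s(a, b) = 0 :=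
  T.wSupport _ h

lemma isSide_of_splitWeight_ne_zero {T : WTree n} {A : Finset (Fin n)} (h : T.splitWeight A ≠ 0) :
    T.IsSide A := by
  by_contra hA
  refine h (Finset.sum_eq_zero fun a _ => Finset.sum_eq_zero fun b _ => ?_)
  split_ifs with hab
  · exact w_eq_zero_of_not_adj fun hadj => hA ⟨a, b, hadj, hab⟩
  · rfl

lemma splitWeight_empty (T : WTree n) : T.splitWeight ∅ = 0 := by
  by_contra h
  obtain ⟨a, b, hab, h⟩ := isSide_of_splitWeight_ne_zero h
  exact (side_nonempty hab).ne_empty h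

lemma splitWeight_compl (T : WTree n) (A : Finset (Fin n)) :
    T.splitWeight Aᶜ = T.splitWeight A := by
  unfold splitWeight
  rw [Finset.sum_comm]
  refine Finset.sum_congr rfl fun a _ => Finset.sum_congr rfl fun b _ => ?_
  by_cases h : T.G.Adj a b
  · rw [side_swap h, Sym2.eq_swap]
    simp only [compl_inj_iff]
  · rw [w_eq_zero_of_not_adj h, Sym2.eq_swap, w_eq_zero_of_not_adj h]
    simp

lemma IsPseudostar.card_le {T : WTree n} {k : ℕ} (hT : T.IsPseudostar k)
    {A : Finset (Fin n)} (h : T.splitWeight A ≠ 0) : A.card ≤ n - k ∨ Aᶜ.card ≤ n - k := by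
  obtain ⟨a, b, hab, rfl⟩ := isSide_of_splitWeight_ne_zero h
  have := hT a b hab
  rw [← coe_side, Sym2.eq_swap, ← coe_side, Set.ncard_coe_finset, Set.ncard_coe_finset,
    side_swap hab] at this
  have h1 := Finset.card_compl (T.side a b)
  have h2 := Finset.card_le_univ (T.side a b)
  rw [Fintype.card_fin] at h1 h2
  omega

lemma w_eq_zero_of_isDiag (T : WTree n) (e : Sym2 T.V) (h : e.IsDiag) : T.w e = 0 :=
  T.wSupport e fun he => T.G.not_isDiag_of_mem_edgeSet he h

open Classical in
lemma two_mul_Dtot (T : WTree n) : 2 * T.Dtot = ∑ a, ∑ b, T.w s(a, b) := by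
  rw [Sym2.sum_sum_mk_eq_two_mul_sum T.w T.w_eq_zero_of_isDiag, Dtot,
    finsum_mem_eq_finite_toFinset_sum _ (Set.toFinite _)]
  congr 1
  refine Finset.sum_subset (Finset.subset_univ _) fun e _ he => T.wSupport e ?_
  simpa using he

open Classical in
lemma two_mul_D (T : WTree n) (I : Finset (Fin n)) :
    2 * T.D I = ∑ a, ∑ b, if s(a, b) ∈ T.subtreeEdges I then T.w s(a, b) else 0 := by
  rw [Sym2.sum_sum_mk_eq_two_mul_sum (fun e => if e ∈ T.subtreeEdges I then T.w e else 0)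
    (fun e he => by simp [T.w_eq_zero_of_isDiag e he]), D,
    finsum_mem_eq_finite_toFinset_sum _ (Set.toFinite _), ← Finset.sum_filter]
  congr 1
  refine Finset.sum_congr ?_ fun _ _ => rfl
  ext e
  simp

lemma sum_splitWeight (T : WTree n) : ∑ A, T.splitWeight A = 2 * T.Dtot := by
  rw [two_mul_Dtot]
  unfold splitWeight
  rw [Finset.sum_comm]
  refine Finset.sum_congr rfl fun a _ => ?_
  rw [Finset.sum_comm]
  simp

lemma notMem_subtreeEdges_iff {T : WTree n} {a b : T.V} (h : T.G.Adj a b) {I : Finset (Fin n)} :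
    s(a, b) ∉ T.subtreeEdges I ↔ T.side a b ⊆ Iᶜ ∨ T.side b a ⊆ Iᶜ := by
  rw [side_swap h, Finset.compl_subset_compl]
  simp only [subtreeEdges, pathEdges, Set.mem_ofPred_eq, T.isTree.exists_isPath_mem_edges_iff,
    reachable_iff_mem_side_iff h, Finset.subset_iff, Finset.mem_compl, Finset.mem_coe]
  push Not
  constructor
  · intro hI
    by_contra! hcon
    obtain ⟨⟨i, hi, hiI⟩, j, hj, hjs⟩ := hcon
    exact hjs ((hI i hiI j hj).1 hi)
  · rintro (hI | hI) i hi j hj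
    · exact ⟨fun hs => absurd hi (hI hs), fun hs => absurd hj (hI hs)⟩
    · exact ⟨fun _ => hI hj, fun _ => hI hi⟩

lemma sum_powerset_splitWeight (T : WTree n) {I : Finset (Fin n)} (hI : I.Nonempty) :
    ∑ A ∈ Iᶜ.powerset, T.splitWeight A = T.Dtot - T.D I := by
  classical
  have h1 : ∑ A ∈ Iᶜ.powerset, T.splitWeight A =
      ∑ a, ∑ b, if T.side a b ⊆ Iᶜ then T.w s(a, b) else 0 := by
    unfold splitWeight
    rw [Finset.sum_comm]
    refine Finset.sum_congr rfl fun a _ => ?_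
    rw [Finset.sum_comm]
    simp
  have h2 : ∑ A ∈ Iᶜ.powerset, T.splitWeight A =
      ∑ a, ∑ b, if T.side b a ⊆ Iᶜ then T.w s(a, b) else 0 := by
    rw [h1, Finset.sum_comm]
    simp_rw [Sym2.eq_swap]
  have h3 : 2 * T.Dtot - 2 * T.D I = ∑ a, ∑ b, ((if T.side a b ⊆ Iᶜ then T.w s(a, b) else 0) +
      if T.side b a ⊆ Iᶜ then T.w s(a, b) else 0) := by
    rw [two_mul_Dtot, two_mul_D]
    simp_rw [← Finset.sum_sub_distrib]
    refine Finset.sum_congr rfl fun a _ => Finset.sum_congr rfl fun b _ => ?_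
    by_cases h : T.G.Adj a b
    · have hiff := notMem_subtreeEdges_iff h (I := I)
      have hexcl : ¬ (T.side a b ⊆ Iᶜ ∧ T.side b a ⊆ Iᶜ) := by
        rintro ⟨ha, hb⟩
        obtain ⟨i, hi⟩ := hI
        rw [side_swap h, Finset.compl_subset_compl] at hb
        exact Finset.mem_compl.1 (ha (hb hi)) hi
      split_ifs <;> first | tauto | simp
    · simp [w_eq_zero_of_not_adj h]
  simp_rw [Finset.sum_add_distrib] at h3
  linarith

/-- Two pseudostars of kind `(n, k)` with the same `k`-weights have the same total weight. -/
theorem Dtot_eq_of_isPseudostar {k : ℕ} (h3 : 3 ≤ k) (hk : k ≤ n - 1) {T T' : WTree n}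
    (hT : T.IsPseudostar k) (hT' : T'.IsPseudostar k)
    (hD : ∀ I : Finset (Fin n), I.card = k → T.D I = T'.D I) : T.Dtot = T'.Dtot := by
  have hs : ∀ A, T.splitWeight A - T'.splitWeight A ≠ 0 →
      T.splitWeight A ≠ 0 ∨ T'.splitWeight A ≠ 0 := by
    intro A hA
    by_contra! h
    exact hA (by rw [h.1, h.2, sub_zero])
  refine sub_eq_zero.1 (sum_eq_zero_of_nonCrossing T.nonCrossing_isSide T'.nonCrossing_isSide
    (h := fun A => T.splitWeight A - T'.splitWeight A) (c := n - k) (t := T.Dtot - T'.Dtot)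
    ?_ ?_ ?_ ?_ ?_ ?_ ?_ ?_)
  · simp [splitWeight_empty]
  · exact fun A hA => (hs A hA).imp isSide_of_splitWeight_ne_zero isSide_of_splitWeight_ne_zero
  · omega
  · rw [Fintype.card_fin]; omega
  · intro J hJ
    have hc : Jᶜ.card = k := by
      rw [Finset.card_compl, Fintype.card_fin]; omega
    have hne : Jᶜ.Nonempty := Finset.card_pos.1 (by omega)
    have e := T.sum_powerset_splitWeight hne
    have e' := T'.sum_powerset_splitWeight hne
    rw [compl_compl] at e e'
    rw [Finset.sum_sub_distrib, e, e', hD _ hc]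
    ring
  · intro A
    rw [splitWeight_compl, splitWeight_compl]
  · exact fun A hA => (hs A hA).elim hT.card_le hT'.card_le
  · rw [Finset.sum_sub_distrib, sum_splitWeight, sum_splitWeight]
    ring

end WTree

/-- let `3 ≤ k ≤ n-1`, let `{D_I}` be an l-treelike family of real numbers
and let `U` be the set of weighted trees with leaf set `[n]` realizing the family. If
every element of `U` is a pseudostar of kind `(n,k)`, then all elements of `U` have the
same total weight. -/
theorem statement12 (n k : ℕ) (h3 : 3 ≤ k) (hk : k ≤ n - 1)
    (D₀ : Finset (Fin n) → ℝ) (hD : ∃ T : WTree n, T.Realizes k D₀)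
    (hall : ∀ T : WTree n, T.Realizes k D₀ → T.IsPseudostar k)
    (P P' : WTree n) (hP : P.Realizes k D₀) (hP' : P'.Realizes k D₀) :
    P.Dtot = P'.Dtot := by
  exact WTree.Dtot_eq_of_isPseudostar h3 hk (hall P hP) (hall P' hP')
    fun I hI => (hP I hI).trans (hP' I hI).symm
end
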